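/- arXiv:2407.19999 — 2 statements merged into one kernel-verified Lean document; each statement's English description precedes it below -/
import Mathlib

section
/- Let R be a generically Gorenstein Cohen–Macaulay local ring with canonical module ω, and suppose the trace ideal tr(ω) is a radical ideal. Then the stable annihilator of ω equals the Auslander–Reiten annihilator of ω: ann_R Ext^1_R(ω, Ωω) = ⋂_{i>0} ann_R Ext^i_R(ω, ω ⊕ R). -/
open CategoryTheory Opposite IsLocalRing

universe u

variable (R : Type u) [CommRing R]

/-- The Ext module `Ext^i_R(M, N)` as an object of `ModuleCat R`. -/
noncomputable def ExtMod (i : ℕ) (M N : Type u) [AddCommGroup M] [Module R M]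
    [AddCommGroup N] [Module R N] : ModuleCat.{u} R :=
  ((Ext R (ModuleCat.{u} R) i).obj (op (ModuleCat.of R M))).obj (ModuleCat.of R N)

/-- The annihilator of `Ext^i_R(M, N)`. -/
noncomputable def extAnn (i : ℕ) (M N : Type u) [AddCommGroup M] [Module R M]
    [AddCommGroup N] [Module R N] : Ideal R :=
  Module.annihilator R (ExtMod R i M N)

/-- `S` is a (first) syzygy of `M`: the kernel of a surjection from a
finitely generated free module onto `M`. -/
def IsSyzygy (M S : Type u) [AddCommGroup M] [Module R M] [AddCommGroup S] [Module R S] : Prop :=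
  ∃ (F : Type u) (_ : AddCommGroup F) (_ : Module R F) (ι : S →ₗ[R] F) (π : F →ₗ[R] M),
    Module.Free R F ∧ Module.Finite R F ∧ Function.Injective ι ∧ Function.Surjective π ∧
      LinearMap.range ι = LinearMap.ker π

/-- The submodule of `Hom_R(M,N)` of maps factoring through a free module. -/
def stablyTrivial (M N : Type u) [AddCommGroup M] [Module R M] [AddCommGroup N] [Module R N] :
    Submodule R (M →ₗ[R] N) :=
  Submodule.span R {f : M →ₗ[R] N | ∃ (F : Type u) (_ : AddCommGroup F) (_ : Module R F),
    Module.Free R F ∧ ∃ (g : M →ₗ[R] F) (h : F →ₗ[R] N), h ∘ₗ g = f}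

/-- The stable annihilator of `M`: the annihilator of `End_R(M)/P(M,M)`. -/
noncomputable def stableAnn (M : Type u) [AddCommGroup M] [Module R M] : Ideal R :=
  Module.annihilator R ((M →ₗ[R] M) ⧸ stablyTrivial R M M)

/-- The Auslander–Reiten annihilator `⋂_{i>0} ann Ext^i(M, M ⊕ R)`. -/
noncomputable def ARann (M : Type u) [AddCommGroup M] [Module R M] : Ideal R :=
  ⨅ i : ℕ, extAnn R (i + 1) M (M × R)

/-- Depth of a module over a local ring: supremum of lengths of regular sequences
contained in the maximal ideal. -/
noncomputable def moduleDepth [IsLocalRing R] (M : Type u) [AddCommGroup M] [Module R M] : ℕ∞ :=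
  sSup {n : ℕ∞ | ∃ rs : List R, (∀ r ∈ rs, r ∈ maximalIdeal R) ∧
    RingTheory.Sequence.IsRegular M rs ∧ (rs.length : ℕ∞) = n}

/-- `ω` is a canonical module of the `d`-dimensional Cohen-Macaulay local ring `R`:
it is finitely generated and `Ext^i(k, ω)` vanishes for `i ≠ d` and is `k` for `i = d`. -/
def IsCanonicalModule [IsLocalRing R] (d : ℕ) (ω : Type u) [AddCommGroup ω] [Module R ω] :
    Prop :=
  Module.Finite R ω ∧
    (∀ i : ℕ, i ≠ d → Subsingleton (ExtMod R i (ResidueField R) ω)) ∧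
    Nonempty ((ExtMod R d (ResidueField R) ω) ≃ₗ[R] ResidueField R)

/-- A Gorenstein local ring: Noetherian local, and the ring itself is a canonical module. -/
def IsGorensteinLocal (A : Type u) [CommRing A] [IsLocalRing A] : Prop :=
  IsNoetherianRing A ∧ ∃ d : ℕ, ringKrullDim A = d ∧ IsCanonicalModule A d A

/-- A regular local ring: Noetherian local whose maximal ideal is generated by
`dim` elements. -/
def IsRegularLocal (A : Type u) [CommRing A] [IsLocalRing A] : Prop :=
  IsNoetherianRing A ∧ ∃ (d : ℕ) (s : Finset A), ringKrullDim A = (d : ℕ) ∧ s.card = d ∧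
    Ideal.span (s : Set A) = maximalIdeal A

/-- `S` is an `n`-th syzygy of `M`. -/
def IsNthSyzygy : (n : ℕ) → ∀ (M S : Type u) [AddCommGroup M] [Module R M]
    [AddCommGroup S] [Module R S], Prop
  | 0 => fun M S _ _ _ _ => Nonempty (M ≃ₗ[R] S)
  | n + 1 => fun M S _ _ _ _ => ∃ (T : Type u) (_ : AddCommGroup T) (_ : Module R T),
      IsSyzygy R M T ∧ IsNthSyzygy n T S

/-- Maximal Cohen-Macaulay module: finitely generated with depth equal to the
Krull dimension of the ring. -/
def IsMCM [IsLocalRing R] (M : Type u) [AddCommGroup M] [Module R M] : Prop :=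
  Module.Finite R M ∧ (moduleDepth R M : WithBot ℕ∞) = ringKrullDim R

/-- The trace ideal of a module. -/
def traceIdeal (M : Type u) [AddCommGroup M] [Module R M] : Ideal R :=
  ⨆ f : M →ₗ[R] R, LinearMap.range f

namespace S13
open Abelian CochainComplex HomComplex

section compare
variable {R : Type u} [CommRing R] {X Y : ModuleCat.{u} R} (P : ProjectiveResolution X)

lemma extMk_smul {n : ℕ} (f : P.complex.X n ⟶ Y) (m : ℕ) (hm : n + 1 = m)
    (hf : P.complex.d m n ≫ f = 0) (r : R) :
    P.extMk (r • f) m hm (by simp [hf]) = r • P.extMk f m hm hf := by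
  rw [Ext.smul_eq_comp_mk₀, ProjectiveResolution.extMk_comp_mk₀]
  congr 1

lemma extMk_eq_zero_iff_zero (f : P.complex.X 0 ⟶ Y) (hf : P.complex.d 1 0 ≫ f = 0) :
    P.extMk f 1 rfl hf = 0 ↔ f = 0 := by
  constructor
  · intro h
    rw [← P.extEquivCohomologyClass.apply_eq_iff_eq,
      ProjectiveResolution.extEquivCohomologyClass_extMk,
      ProjectiveResolution.extEquivCohomologyClass_zero,
      CohomologyClass.mk_eq_zero_iff] at h
    rw [Cocycle.toSingleMk_mem_coboundaries_iff _ _ _ _ _ (1) (by lia)] at h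
    obtain ⟨g, hg⟩ := h
    have hz : Limits.IsZero (P.cochainComplex.X 1) :=
      P.cochainComplex.isZero_of_isStrictlyLE 0 1 (by lia)
    have : g = 0 := hz.eq_of_src _ _
    rw [this] at hg
    simpa using hg.symm
  · rintro rfl
    simp

lemma sc_g_iff (n : ℕ) (f : P.complex.X n ⟶ Y) :
    ((P.complex.linearYonedaObj R Y).sc n).g.hom f = 0 ↔ P.complex.d (n + 1) n ≫ f = 0 := by
  change ((P.complex.linearYonedaObj R Y).d n ((ComplexShape.up ℕ).next n)).hom f = 0 ↔ _
  have h : (ComplexShape.up ℕ).next n = n + 1 := CochainComplex.next ℕ n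
  rw [h]
  rfl

lemma sc_f_range (n : ℕ) (f : P.complex.X n ⟶ Y) (hf : P.complex.d (n + 1) n ≫ f = 0) :
    (∃ g, ((P.complex.linearYonedaObj R Y).sc n).f.hom g = f) ↔ P.extMk f (n + 1) rfl hf = 0 := by
  change (∃ g, ((P.complex.linearYonedaObj R Y).d ((ComplexShape.up ℕ).prev n) n).hom g = f) ↔ _
  cases n with
  | zero =>
    rw [extMk_eq_zero_iff_zero, HomologicalComplex.shape _ _ _ (by simp)]
    constructor
    · rintro ⟨g, rfl⟩
      rfl
    · rintro rfl
      exact ⟨0, rfl⟩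
  | succ n =>
    have h : (ComplexShape.up ℕ).prev (n + 1) = n := by simp
    rw [h, P.extMk_eq_zero_iff _ _ _ _ n rfl]
    rfl

noncomputable def cycMap (n : ℕ) :
    LinearMap.ker (((P.complex.linearYonedaObj R Y).sc n).g.hom) →ₗ[R] Ext X Y n where
  toFun z := P.extMk (z.1 : P.complex.X n ⟶ Y) (n+1) rfl ((sc_g_iff P n _).1 z.2)
  map_add' x y := (P.add_extMk _ _ _ _ _ _).symm
  map_smul' r x := extMk_smul P _ _ _ _ _

noncomputable def compareL (n : ℕ) :
    ((Ext R (ModuleCat.{u} R) n).obj (op X)).obj Y ≃ₗ[R] Ext X Y n := by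
  let S := (P.complex.linearYonedaObj R Y).sc n
  refine ((P.isoExt (R := R) n Y) ≪≫ S.moduleCatHomologyIso).toLinearEquiv ≪≫ₗ ?_
  change (_ ⧸ LinearMap.range S.moduleCatToCycles) ≃ₗ[R] _
  refine (Submodule.quotEquivOfEq _ _ ?_) ≪≫ₗ LinearMap.quotKerEquivOfSurjective (cycMap P n) ?_
  · ext z
    rw [LinearMap.mem_ker]
    refine Iff.trans ?_ (sc_f_range P n z.1 ((sc_g_iff P n _).1 z.2))
    constructor
    · rintro ⟨g, rfl⟩
      exact ⟨g, rfl⟩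
    · rintro ⟨g, hg⟩
      exact ⟨g, Subtype.ext hg⟩
  · intro e
    obtain ⟨f, hf, rfl⟩ := P.extMk_surjective e (n+1) rfl
    exact ⟨⟨f, (sc_g_iff P n f).2 hf⟩, rfl⟩
end compare

/-- Comparison of the two versions of Ext. -/
noncomputable def extEquiv (R : Type u) [CommRing R] (i : ℕ) (M N : Type u) [AddCommGroup M]
    [Module R M] [AddCommGroup N] [Module R N] :
    ExtMod R i M N ≃ₗ[R] Ext (ModuleCat.of R M) (ModuleCat.of R N) i :=
  compareL (projectiveResolution (ModuleCat.of R M)) i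

lemma mem_extAnn {R : Type u} [CommRing R] {i : ℕ} {M N : Type u} [AddCommGroup M]
    [Module R M] [AddCommGroup N] [Module R N] {a : R} :
    a ∈ extAnn R i M N ↔ ∀ x : Ext (ModuleCat.of R M) (ModuleCat.of R N) i, a • x = 0 := by
  rw [extAnn, (extEquiv R i M N).annihilator_eq, Module.mem_annihilator]
end S13

namespace S13
section api
open Abelian
variable {R : Type u} [CommRing R]

/-- Ext modules via the derived category. -/
abbrev E (R : Type u) [CommRing R] (i : ℕ) (M N : Type u) [AddCommGroup M]
    [Module R M] [AddCommGroup N] [Module R N] : Type u :=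
  Abelian.Ext (ModuleCat.of R M) (ModuleCat.of R N) i

variable {M M' M'' N N' N'' : Type u} [AddCommGroup M] [Module R M] [AddCommGroup M'] [Module R M']
  [AddCommGroup M''] [Module R M'']
  [AddCommGroup N] [Module R N] [AddCommGroup N'] [Module R N']
  [AddCommGroup N''] [Module R N'']

noncomputable def pull (i : ℕ) (N : Type u) [AddCommGroup N] [Module R N] (f : M →ₗ[R] M') :
    E R i M' N →ₗ[R] E R i M N where
  toFun x := (Ext.mk₀ (ModuleCat.ofHom f)).comp x (zero_add i)
  map_add' x y := by simp
  map_smul' r x := by simp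

noncomputable def push (i : ℕ) (M : Type u) [AddCommGroup M] [Module R M] (f : N →ₗ[R] N') :
    E R i M N →ₗ[R] E R i M N' where
  toFun x := x.comp (Ext.mk₀ (ModuleCat.ofHom f)) (add_zero i)
  map_add' x y := by simp
  map_smul' r x := by simp

lemma pull_comp (i : ℕ) (f : M →ₗ[R] M') (g : M' →ₗ[R] M'') (x : E R i M'' N) :
    pull i N (g ∘ₗ f) x = pull i N f (pull i N g x) := by
  simp [pull]

lemma pull_smul_id (i : ℕ) (a : R) (x : E R i M N) :
    pull i N (a • (LinearMap.id : M →ₗ[R] M)) x = a • x := by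
  have : ModuleCat.ofHom (a • (LinearMap.id : M →ₗ[R] M)) = a • 𝟙 (ModuleCat.of R M) := rfl
  simp only [pull, LinearMap.coe_mk, AddHom.coe_mk, this, Ext.mk₀_smul, Ext.smul_comp,
    Ext.mk₀_id_comp]

lemma push_smul_id (i : ℕ) (a : R) (x : E R i M N) :
    push i M (a • (LinearMap.id : N →ₗ[R] N)) x = a • x := by
  have : ModuleCat.ofHom (a • (LinearMap.id : N →ₗ[R] N)) = a • 𝟙 (ModuleCat.of R N) := rfl
  simp only [push, LinearMap.coe_mk, AddHom.coe_mk, this, Ext.mk₀_smul, Ext.comp_smul,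
    Ext.comp_mk₀_id]

lemma push_comp (i : ℕ) (f : N →ₗ[R] N') (g : N' →ₗ[R] N'') (x : E R i M N) :
    push i M (g ∘ₗ f) x = push i M g (push i M f x) := by
  simp [push]

/-- Degree zero. -/
noncomputable def hom0 (M N : Type u) [AddCommGroup M] [Module R M] [AddCommGroup N] [Module R N] :
    (M →ₗ[R] N) ≃ₗ[R] E R 0 M N :=
  LinearEquiv.ofBijective
    { toFun := fun f => Ext.mk₀ (ModuleCat.ofHom f)
      map_add' := fun f g => by rw [ModuleCat.ofHom_add, Ext.mk₀_add]
      map_smul' := fun r f => by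
        have : ModuleCat.ofHom (r • f) = r • ModuleCat.ofHom f := rfl
        rw [this, Ext.mk₀_smul]; rfl } (by
      constructor
      · intro f g h
        have := Ext.mk₀_bijective _ _ |>.1 h
        exact ModuleCat.hom_ext_iff.1 this
      · intro x
        obtain ⟨f, rfl⟩ := Ext.mk₀_bijective _ _ |>.2 x
        exact ⟨f.hom, rfl⟩)

lemma pull_hom0 (f : M →ₗ[R] M') (g : M' →ₗ[R] N) :
    pull 0 N f (hom0 M' N g) = hom0 M N (g ∘ₗ f) := by
  exact Ext.mk₀_comp_mk₀ (ModuleCat.ofHom f) (ModuleCat.ofHom g)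

lemma push_hom0 (f : M →ₗ[R] N) (g : N →ₗ[R] N') :
    push 0 M g (hom0 M N f) = hom0 M N' (g ∘ₗ f) := by
  exact Ext.mk₀_comp_mk₀ (ModuleCat.ofHom f) (ModuleCat.ofHom g)

instance E_free [Module.Free R M] (i : ℕ) : Subsingleton (E R (i + 1) M N) := by
  have : Projective (ModuleCat.of R M) := by
    rw [← IsProjective.iff_projective]; infer_instance
  exact Ext.subsingleton_of_projective _ _ _

section les
variable (f : M' →ₗ[R] M) (g : M →ₗ[R] M'') (hf : Function.Injective f)
  (hg : Function.Surjective g) (hfg : Function.Exact f g)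

/-- Short complex. -/
abbrev sc : ShortComplex (ModuleCat.{u} R) :=
  ModuleCat.shortComplexOfCompEqZero f g hfg.linearMap_comp_eq_zero

lemma sc_se (f : M' →ₗ[R] M) (g : M →ₗ[R] M'')
    (hf : Function.Injective f) (hg : Function.Surjective g) (hfg : Function.Exact f g) : (sc f g hfg).ShortExact :=
  ModuleCat.shortComplex_shortExact _ hfg hf hg

noncomputable def dC (i : ℕ) (N : Type u) [AddCommGroup N] [Module R N] :
    E R i M' N →ₗ[R] E R (i + 1) M'' N where
  toFun x := (sc_se f g hf hg hfg).extClass.comp x (add_comm 1 i)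
  map_add' x y := by simp
  map_smul' r x := by simp

noncomputable def dV (i : ℕ) (N : Type u) [AddCommGroup N] [Module R N] :
    E R i N M'' →ₗ[R] E R (i + 1) N M' where
  toFun x := x.comp (sc_se f g hf hg hfg).extClass rfl
  map_add' x y := by simp
  map_smul' r x := by simp

lemma pull_exact (f : M' →ₗ[R] M) (g : M →ₗ[R] M'')
    (hf : Function.Injective f) (hg : Function.Surjective g) (hfg : Function.Exact f g) (i : ℕ) : Function.Exact (pull i N g) (pull i N f) := by
  intro x
  constructor
  · intro h
    exact Ext.contravariant_sequence_exact₂ (sc_se f g hf hg hfg) _ x h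
  · rintro ⟨y, rfl⟩
    rw [← pull_comp, hfg.linearMap_comp_eq_zero]
    have := pull_smul_id (M := M') (N := N) i (0 : R)
    simp only [pull, LinearMap.coe_mk, AddHom.coe_mk]
    have : ModuleCat.ofHom (0 : M' →ₗ[R] M'') = 0 := rfl
    simp [this]

lemma pull_dC_exact (i : ℕ) : Function.Exact (pull i N f) (dC f g hf hg hfg i N) := by
  intro x
  constructor
  · intro h
    exact Ext.contravariant_sequence_exact₁ (sc_se f g hf hg hfg) _ x (add_comm 1 i) h
  · rintro ⟨y, rfl⟩
    exact ShortComplex.ShortExact.extClass_comp_assoc (sc_se f g hf hg hfg) y (h := add_comm 1 i)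

lemma dC_pull_exact (i : ℕ) : Function.Exact (dC f g hf hg hfg i N) (pull (i + 1) N g) := by
  intro x
  constructor
  · intro h
    exact Ext.contravariant_sequence_exact₃ (sc_se f g hf hg hfg) _ x h (add_comm 1 i)
  · rintro ⟨y, rfl⟩
    exact ShortComplex.ShortExact.comp_extClass_assoc (sc_se f g hf hg hfg) y (add_comm 1 i)

lemma push_exact (f : M' →ₗ[R] M) (g : M →ₗ[R] M'')
    (hf : Function.Injective f) (hg : Function.Surjective g) (hfg : Function.Exact f g) (i : ℕ) : Function.Exact (push i N f) (push i N g) := by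
  intro x
  constructor
  · intro h
    exact Ext.covariant_sequence_exact₂ _ (sc_se f g hf hg hfg) x h
  · rintro ⟨y, rfl⟩
    rw [← push_comp, hfg.linearMap_comp_eq_zero]
    simp only [push, LinearMap.coe_mk, AddHom.coe_mk]
    have : ModuleCat.ofHom (0 : M' →ₗ[R] M'') = 0 := rfl
    simp [this]

lemma push_dV_exact (i : ℕ) : Function.Exact (push i N g) (dV f g hf hg hfg i N) := by
  intro x
  constructor
  · intro h
    exact Ext.covariant_sequence_exact₃ _ (sc_se f g hf hg hfg) x rfl h
  · rintro ⟨y, rfl⟩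
    change (Ext.comp (Ext.comp y (Ext.mk₀ (ModuleCat.ofHom g)) (add_zero i))
      (sc_se f g hf hg hfg).extClass rfl) = 0
    rw [Ext.comp_assoc_of_second_deg_zero,
      ShortComplex.ShortExact.comp_extClass (sc_se f g hf hg hfg), Ext.comp_zero]

lemma dV_push_exact (i : ℕ) : Function.Exact (dV f g hf hg hfg i N) (push (i + 1) N f) := by
  intro x
  constructor
  · intro h
    exact Ext.covariant_sequence_exact₁ _ (sc_se f g hf hg hfg) x h rfl
  · rintro ⟨y, rfl⟩
    change (Ext.comp (Ext.comp y (sc_se f g hf hg hfg).extClass rfl)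
      (Ext.mk₀ (ModuleCat.ofHom f)) (add_zero (i + 1))) = 0
    rw [Ext.comp_assoc_of_third_deg_zero,
      ShortComplex.ShortExact.extClass_comp (sc_se f g hf hg hfg), Ext.comp_zero]

end les

lemma pull_zero_inj (g : M →ₗ[R] M'') (hg : Function.Surjective g) :
    Function.Injective (pull 0 N g) := by
  intro x y h
  obtain ⟨x, rfl⟩ := (hom0 _ _).surjective x
  obtain ⟨y, rfl⟩ := (hom0 _ _).surjective y
  rw [pull_hom0, pull_hom0, EmbeddingLike.apply_eq_iff_eq] at h
  congr 1
  ext z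
  obtain ⟨z, rfl⟩ := hg z
  exact LinearMap.congr_fun h z

lemma pull_equiv (i : ℕ) (e : M ≃ₗ[R] M') : Nonempty (E R i M' N ≃ₗ[R] E R i M N) := by
  refine ⟨LinearEquiv.ofLinearMap (pull i N e.toLinearMap) (pull i N e.symm.toLinearMap) ?_ ?_⟩
  · ext x
    have h1 : e.symm.toLinearMap ∘ₗ e.toLinearMap = (1 : R) • LinearMap.id := by ext; simp
    rw [LinearMap.comp_apply, ← pull_comp, h1, pull_smul_id, one_smul]; rfl
  · ext x
    have h1 : e.toLinearMap ∘ₗ e.symm.toLinearMap = (1 : R) • LinearMap.id := by ext; simp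
    rw [LinearMap.comp_apply, ← pull_comp, h1, pull_smul_id, one_smul]; rfl

lemma E_finite [IsNoetherianRing R] [Module.Finite R M] [Module.Finite R N] (i : ℕ) :
    Module.Finite R (E R i M N) := by
  have : Module.Finite R (ModuleCat.of R M) := ‹Module.Finite R M›
  have : Module.Finite R (ModuleCat.of R N) := ‹Module.Finite R N›
  exact ModuleCat.finite_ext R (ModuleCat.of R M) (ModuleCat.of R N) i

lemma smul_E_zero {a : R} (h : ∀ x : M, a • x = 0) (i : ℕ) (x : E R i M N) : a • x = 0 := by
  have h1 : a • (LinearMap.id : M →ₗ[R] M) = 0 := by ext x; simpa using h x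
  have h2 : (0 : R) • (LinearMap.id : M →ₗ[R] M) = 0 := by simp
  rw [← pull_smul_id, h1, ← h2, pull_smul_id, zero_smul]

end api
end S13

namespace S13
section vanish
variable {R : Type u} [CommRing R]
variable {M M' M'' N N' N'' : Type u} [AddCommGroup M] [Module R M] [AddCommGroup M'] [Module R M']
  [AddCommGroup M''] [Module R M'']
  [AddCommGroup N] [Module R N] [AddCommGroup N'] [Module R N']
  [AddCommGroup N''] [Module R N'']

lemma E_mid (f : M' →ₗ[R] M) (g : M →ₗ[R] M'') (hf : Function.Injective f)
    (hg : Function.Surjective g) (hfg : Function.Exact f g) (i : ℕ)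
    (h1 : Subsingleton (E R i M' N)) (h2 : Subsingleton (E R i M'' N)) :
    Subsingleton (E R i M N) := by
  refine subsingleton_of_forall_eq 0 fun x => ?_
  obtain ⟨y, rfl⟩ := (pull_exact (N := N) f g hf hg hfg i x).1 (Subsingleton.elim _ _)
  rw [Subsingleton.elim y 0, map_zero]

lemma E_sub_left [Subsingleton M] (i : ℕ) : Subsingleton (E R i M N) := by
  refine subsingleton_of_forall_eq 0 fun x => ?_
  have := smul_E_zero (M := M) (N := N) (a := (1 : R)) (fun x => Subsingleton.elim _ _) i x
  rwa [one_smul] at this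

lemma E_vanish_of_primes [IsNoetherianRing R] (J : Ideal R) (i : ℕ)
    (h : ∀ q : Ideal R, q.IsPrime → J ≤ q → Subsingleton (E R i (R ⧸ q) N))
    (hM : Module.Finite R M) (hJ : ∀ a ∈ J, ∀ x : M, a • x = 0) : Subsingleton (E R i M N) := by
  revert hJ
  induction hM using IsNoetherianRing.induction_on_isQuotientEquivQuotientPrime R with
  | subsingleton M => intro _; exact E_sub_left i
  | quotient M p e =>
    intro hJ
    have hle : J ≤ p.1 := by
      intro a ha
      have h1 := hJ a ha (e.symm 1)
      rw [← map_smul] at h1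
      have h2 : a • (1 : R ⧸ p.1) = 0 := e.symm.injective (by rw [h1, map_zero])
      rw [Algebra.smul_def, mul_one] at h2
      exact Ideal.Quotient.eq_zero_iff_mem.1 h2
    have := h p.1 p.2 hle
    obtain ⟨e'⟩ := pull_equiv (N := N) i e
    exact e'.symm.toEquiv.subsingleton
  | exact N₁ N₂ N₃ f g hf hg hfg h₁ h₃ =>
    intro hJ
    refine E_mid f g hf hg hfg i (h₁ fun a ha x => hf ?_) (h₃ fun a ha x => ?_)
    · rw [map_smul, hJ a ha, map_zero]
    · obtain ⟨x, rfl⟩ := hg x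
      rw [← map_smul, hJ a ha, map_zero]

lemma nakayama_smul [IsLocalRing R] [Module.Finite R M] {x : R} (hx : x ∈ maximalIdeal R)
    (h : ∀ y : M, ∃ z : M, y = x • z) : Subsingleton M := by
  have h0 : (⊤ : Submodule R M) = ⊥ := by
    refine Submodule.eq_bot_of_le_smul_of_le_jacobson_bot (maximalIdeal R) ⊤ Module.Finite.fg_top ?_
      (IsLocalRing.jacobson_eq_maximalIdeal ⊥ bot_ne_top).ge
    intro y _
    obtain ⟨z, rfl⟩ := h y
    exact Submodule.smul_mem_smul hx trivial
  exact (Submodule.subsingleton_iff R).1 (subsingleton_of_bot_eq_top h0.symm)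

lemma exact_smul_quot (x : R) : Function.Exact (x • (LinearMap.id : M →ₗ[R] M))
    (LinearMap.range (x • (LinearMap.id : M →ₗ[R] M))).mkQ := by
  exact LinearMap.exact_map_mkQ_range _

theorem F0F2 [IsNoetherianRing R] [IsLocalRing R] [Module.Finite R N] (d : ℕ)
    (h1 : ∀ i, i ≠ d → Subsingleton (E R i (ResidueField R) N))
    (p : Ideal R) (hp : p.IsPrime) (i : ℕ) (hne : ¬ Subsingleton (E R i (R ⧸ p) N)) :
    i ≤ d ∧ (d : ℕ∞) ≤ i + Order.coheight (⟨p, hp⟩ : PrimeSpectrum R) := by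
  revert hp i
  induction p using WellFoundedGT.induction with
  | ind p ih =>
  intro hp i hne
  by_cases hpm : p = maximalIdeal R
  · subst hpm
    have : i = d := by
      by_contra hid
      exact hne (h1 i hid)
    subst this
    exact ⟨le_rfl, le_self_add⟩
  have hlt : p < maximalIdeal R := lt_of_le_of_ne (le_maximalIdeal hp.ne_top) hpm
  obtain ⟨x, hxm, hxp⟩ := SetLike.exists_of_lt hlt
  let f : (R ⧸ p) →ₗ[R] (R ⧸ p) := x • LinearMap.id
  have hf : Function.Injective f := by
    rw [← LinearMap.ker_eq_bot, LinearMap.ker_eq_bot']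
    intro m hm
    have hm : x • m = 0 := hm
    rw [Algebra.smul_def] at hm
    rcases mul_eq_zero.1 hm with h | h
    · exact absurd (Ideal.Quotient.eq_zero_iff_mem.1 h) hxp
    · exact h
  have hfg : Function.Exact f (LinearMap.range f).mkQ := exact_smul_quot x
  have hne2 : ¬ Subsingleton (E R (i + 1) ((R ⧸ p) ⧸ LinearMap.range f) N) := by
    intro hs
    apply hne
    have := E_finite (R := R) (M := R ⧸ p) (N := N) i
    apply nakayama_smul hxm
    intro y
    obtain ⟨z, hz⟩ := (pull_dC_exact (N := N) f (LinearMap.range f).mkQ hf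
      (Submodule.mkQ_surjective _) hfg i y).1 (Subsingleton.elim _ _)
    exact ⟨z, by rw [← hz, pull_smul_id]⟩
  obtain ⟨q, hq, hle, hqne⟩ : ∃ q : Ideal R, q.IsPrime ∧ p ⊔ Ideal.span {x} ≤ q ∧
      ¬ Subsingleton (E R (i + 1) (R ⧸ q) N) := by
    by_contra hcon
    push Not at hcon
    apply hne2
    refine E_vanish_of_primes (p ⊔ Ideal.span {x}) (i + 1) hcon inferInstance ?_
    intro a ha y
    induction y using Submodule.Quotient.induction_on with | _ y =>
    obtain ⟨b, hb, c, hc, rfl⟩ := Submodule.mem_sup.1 ha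
    obtain ⟨c, rfl⟩ := Ideal.mem_span_singleton'.1 hc
    rw [← Submodule.Quotient.mk_smul, Submodule.Quotient.mk_eq_zero]
    refine ⟨c • y, ?_⟩
    have hby : b • y = 0 := by
      rw [Algebra.smul_def]
      have : algebraMap R (R ⧸ p) b = 0 := Ideal.Quotient.eq_zero_iff_mem.2 hb
      rw [this, zero_mul]
    rw [add_smul, hby, zero_add, mul_comm, mul_smul]
    rfl
  have hpq : p < q := by
    refine lt_of_le_of_ne (le_sup_left.trans hle) ?_
    rintro rfl
    exact hxp (hle (Ideal.mem_sup_right (Ideal.mem_span_singleton_self x)))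
  obtain ⟨h2, h3⟩ := ih q hpq hq (i + 1) hqne
  refine ⟨by omega, h3.trans ?_⟩
  have h4 : Order.coheight (⟨q, hq⟩ : PrimeSpectrum R) + 1 ≤
      Order.coheight (⟨p, hp⟩ : PrimeSpectrum R) :=
    Order.coheight_add_one_le (by exact hpq)
  push_cast
  rw [add_assoc, add_comm 1]
  gcongr

theorem F0 [IsNoetherianRing R] [IsLocalRing R] [Module.Finite R N] (d : ℕ)
    (h1 : ∀ i, i ≠ d → Subsingleton (E R i (ResidueField R) N)) (i : ℕ) (hi : d < i)
    [hM : Module.Finite R M] : Subsingleton (E R i M N) := by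
  refine E_vanish_of_primes ⊥ i ?_ hM ?_
  · intro q hq _
    by_contra hne
    have := (F0F2 d h1 q hq i hne).1
    omega
  · intro a ha x
    rw [(Submodule.mem_bot R).1 ha, zero_smul]

theorem F2 [IsNoetherianRing R] [IsLocalRing R] [Module.Finite R N] (d : ℕ)
    (hdim : ringKrullDim R = d)
    (h1 : ∀ i, i ≠ d → Subsingleton (E R i (ResidueField R) N)) (p : Ideal R)
    (hp : IsAssociatedPrime p N) : p ∈ minimalPrimes R := by
  have hpp := hp.isPrime
  have hne : ¬ Subsingleton (E R 0 (R ⧸ p) N) := by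
    intro hs
    obtain ⟨f, hf⟩ := ((isAssociatedPrime_iff_exists_injective_linearMap p N).1 hp).2
    have : f = 0 := (hom0 (R ⧸ p) N).injective (Subsingleton.elim _ _)
    have h2 : (1 : R ⧸ p) = 0 := hf (by simp [this])
    exact hpp.ne_top ((Ideal.eq_top_iff_one p).2 (Ideal.Quotient.eq_zero_iff_mem.1 (by simpa using h2)))
  have h2 := (F0F2 d h1 p hpp 0 hne).2
  rw [minimalPrimes_eq_minimals]
  refine ⟨hpp, fun q hq hqp => ?_⟩
  by_contra hpq
  have hlt : (⟨q, hq⟩ : PrimeSpectrum R) < ⟨p, hpp⟩ := lt_of_le_not_ge hqp hpq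
  have h3 := Order.coheight_add_one_le hlt
  have h4 : ((Order.coheight (⟨q, hq⟩ : PrimeSpectrum R) : ℕ∞) : WithBot ℕ∞) ≤ d :=
    (Order.coheight_le_krullDim _).trans hdim.le
  have h5 : Order.coheight (⟨q, hq⟩ : PrimeSpectrum R) ≤ d := by exact_mod_cast h4
  have h6 : (d : ℕ∞) + 1 ≤ d := by
    calc (d : ℕ∞) + 1 ≤ Order.coheight (⟨p, hpp⟩ : PrimeSpectrum R) + 1 := by
          gcongr; simpa using h2
      _ ≤ _ := h3
      _ ≤ _ := h5
  have : d + 1 ≤ d := by exact_mod_cast h6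
  omega

end vanish
end S13

namespace S13
section endo
variable {R : Type u} [CommRing R]

/-- Duality lengths. -/
def TT (R : Type u) [CommRing R] (M : Type u) [AddCommGroup M] [Module R M] (J : Ideal R)
    (n : ℕ) : Prop :=
  ∀ (N : Type u) [AddCommGroup N] [Module R N], IsFiniteLength R N →
    (∀ a ∈ J, ∀ x : N, a • x = 0) →
    (∀ i < n, Subsingleton (E R i N M)) ∧ Module.length R (E R n N M) = Module.length R N

variable {M : Type u} [AddCommGroup M] [Module R M]

lemma simple_equiv [IsLocalRing R] (h : IsSimpleModule R M) :
    Nonempty (M ≃ₗ[R] ResidueField R) := by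
  obtain ⟨I, hI, ⟨e⟩⟩ := isSimpleModule_iff_quot_maximal.1 h
  obtain rfl := IsLocalRing.eq_maximalIdeal hI
  exact ⟨e⟩

lemma resField_simple [IsLocalRing R] : IsSimpleModule R (ResidueField R) :=
  isSimpleModule_iff_quot_maximal.2 ⟨maximalIdeal R, inferInstance, ⟨LinearEquiv.refl _ _⟩⟩

lemma TT_canonical [IsLocalRing R] (d : ℕ)
    (h1 : ∀ i, i ≠ d → Subsingleton (E R i (ResidueField R) M))
    (h2 : Nonempty (E R d (ResidueField R) M ≃ₗ[R] ResidueField R))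
    (N : Type u) [AddCommGroup N] [Module R N] (hN : IsFiniteLength R N) :
    (∀ i, i ≠ d → Subsingleton (E R i N M)) ∧
      Module.length R (E R d N M) = Module.length R N := by
  induction hN with
  | of_subsingleton =>
    refine ⟨fun i _ => E_sub_left i, ?_⟩
    have := E_sub_left (R := R) (N := M) (M := by assumption) d
    rw [Module.length_eq_zero, Module.length_eq_zero]
  | @of_simple_quotient X _ _ K hs hK ih =>
    obtain ⟨e⟩ := simple_equiv hs
    have hQ : ∀ i, i ≠ d → Subsingleton (E R i (X ⧸ K) M) := by
      intro i hi
      have := h1 i hi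
      obtain ⟨e'⟩ := pull_equiv (N := M) i e
      exact e'.symm.toEquiv.subsingleton
    have hQl : Module.length R (E R d (X ⧸ K) M) = Module.length R (X ⧸ K) := by
      obtain ⟨e'⟩ := pull_equiv (N := M) d e
      obtain ⟨e2⟩ := h2
      rw [e.length_eq, ← e'.length_eq, e2.length_eq]
    have hex : Function.Exact K.subtype K.mkQ := LinearMap.exact_subtype_mkQ K
    have hi := Submodule.subtype_injective K
    have hsu := Submodule.mkQ_surjective K
    refine ⟨fun i hi => E_mid K.subtype K.mkQ (Submodule.subtype_injective K) hsu hex i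
      (ih.1 i hi) (hQ i hi), ?_⟩
    have hinj : Function.Injective (pull d M K.mkQ) := by
      rcases d with _ | d
      · exact pull_zero_inj _ hsu
      · rw [← LinearMap.ker_eq_bot, LinearMap.ker_eq_bot']
        intro y hy
        obtain ⟨z, rfl⟩ := (dC_pull_exact K.subtype K.mkQ hi hsu hex d y).1 hy
        have := ih.1 d (by omega)
        rw [Subsingleton.elim z 0, map_zero]
    have hsurj : Function.Surjective (pull d M K.subtype) := by
      intro y
      have := hQ (d + 1) (by omega)
      exact (pull_dC_exact K.subtype K.mkQ hi hsu hex d y).1 (Subsingleton.elim _ _)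
    rw [Module.length_eq_add_of_exact _ _ hinj hsurj
      (pull_exact K.subtype K.mkQ hi hsu hex d),
      Module.length_eq_add_of_exact K.subtype K.mkQ hi hsu hex, hQl, ih.2, add_comm]

lemma finlen_of_zero_dim [IsNoetherianRing R] [IsLocalRing R] (J : Ideal R)
    (hJ : ∀ p : Ideal R, p.IsPrime → J ≤ p → p = maximalIdeal R)
    (hM : Module.Finite R M) (hJM : ∀ a ∈ J, ∀ x : M, a • x = 0) : IsFiniteLength R M := by
  rw [← Module.length_ne_top_iff]
  revert hJM
  induction hM using IsNoetherianRing.induction_on_isQuotientEquivQuotientPrime R with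
  | subsingleton M => intro _; simp [Module.length_eq_zero]
  | quotient M p e =>
    intro hJM
    have hle : J ≤ p.1 := by
      intro a ha
      have h1 := hJM a ha (e.symm 1)
      rw [← map_smul] at h1
      have h2 : a • (1 : R ⧸ p.1) = 0 := e.symm.injective (by rw [h1, map_zero])
      rw [Algebra.smul_def, mul_one] at h2
      exact Ideal.Quotient.eq_zero_iff_mem.1 h2
    have hpm := hJ p.1 p.2 hle
    have : p.1.IsMaximal := by rw [hpm]; infer_instance
    have : IsSimpleModule R M := isSimpleModule_iff_quot_maximal.2 ⟨p.1, this, ⟨e⟩⟩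
    rw [Module.length_eq_one_iff.2 this]
    simp
  | exact N₁ N₂ N₃ f g hf hg hfg h₁ h₃ =>
    intro hJM
    rw [Module.length_eq_add_of_exact f g hf hg hfg]
    have a1 := h₁ fun a ha x => hf (by rw [map_smul, hJM a ha, map_zero])
    have a2 := h₃ fun a ha x => by
      obtain ⟨x, rfl⟩ := hg x
      rw [← map_smul, hJM a ha, map_zero]
    simp [a1, a2]

lemma length_hom_quot (K : Ideal R) (hK : ∀ a ∈ K, ∀ x : M, a • x = 0) :
    Module.length R ((R ⧸ K) →ₗ[R] M) = Module.length R M := by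
  refine (LinearEquiv.ofBijective (LinearMap.applyₗ (R := R) (M := R ⧸ K) (M₂ := M) 1) ⟨?_, ?_⟩).length_eq
  · intro f g h
    ext
    simpa using h
  · intro m
    refine ⟨Submodule.liftQ K (LinearMap.toSpanSingleton R M m) ?_, ?_⟩
    · intro a ha
      simpa using hK a ha m
    · have : (1 : R ⧸ K) = Submodule.Quotient.mk 1 := rfl
      rw [LinearMap.applyₗ_apply_apply, this, Submodule.liftQ_apply]
      simp

lemma endo_zero [IsNoetherianRing R] [IsLocalRing R] [Module.Finite R M] (J : Ideal R)
    (hJ : ∀ p : Ideal R, p.IsPrime → J ≤ p → p = maximalIdeal R)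
    (hJM : ∀ a ∈ J, ∀ x : M, a • x = 0) (hT : TT R M J 0) :
    (∀ φ : M →ₗ[R] M, ∃ r : R, ∀ x, φ x = r • x) ∧ Module.annihilator R M ≤ J := by
  have hT' : ∀ (N : Type u) [AddCommGroup N] [Module R N], Module.Finite R N →
      (∀ a ∈ J, ∀ x : N, a • x = 0) → Module.length R (N →ₗ[R] M) = Module.length R N ∧
        Module.length R N ≠ ⊤ := by
    intro N _ _ hN hJN
    have hfl := finlen_of_zero_dim J hJ hN hJN
    refine ⟨?_, Module.length_ne_top_iff.2 hfl⟩
    rw [(hom0 N M).length_eq]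
    exact (hT N hfl hJN).2
  have kill : ∀ K : Ideal R, J ≤ K → ∀ a ∈ J, ∀ x : R ⧸ K, a • x = 0 := by
    intro K hK a ha x
    rw [Algebra.smul_def]
    have : algebraMap R (R ⧸ K) a = 0 := Ideal.Quotient.eq_zero_iff_mem.2 (hK ha)
    rw [this, zero_mul]
  have hJann : J ≤ Module.annihilator R M := fun a ha => Module.mem_annihilator.2 (hJM a ha)
  obtain ⟨a1, -⟩ := hT' (R ⧸ J) inferInstance (kill J le_rfl)
  rw [length_hom_quot J hJM] at a1
  obtain ⟨a2, a2'⟩ := hT' (R ⧸ Module.annihilator R M) inferInstance (kill _ hJann)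
  rw [length_hom_quot _ (fun a ha => Module.mem_annihilator.1 ha)] at a2
  obtain ⟨a3, a3'⟩ := hT' M inferInstance hJM
  have hann : Module.annihilator R M ≤ J := by
    let g : (R ⧸ J) →ₗ[R] (R ⧸ Module.annihilator R M) := Submodule.factor hJann
    have hg : Function.Surjective g := Submodule.factor_surjective hJann
    have h := Module.length_eq_add_of_exact (LinearMap.ker g).subtype g
      (Submodule.subtype_injective _) hg (LinearMap.exact_subtype_ker_map g)
    rw [← a1, ← a2] at h
    have h0 : Module.length R (LinearMap.ker g) = 0 := by
      have : 0 + Module.length R M = Module.length R (LinearMap.ker g) + Module.length R M := by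
        rw [zero_add]; exact h
      exact ((ENat.add_left_injective_of_ne_top a3') this).symm
    rw [Module.length_eq_zero_iff] at h0
    intro a ha
    have : (Submodule.Quotient.mk a : R ⧸ J) ∈ LinearMap.ker g := by
      rw [LinearMap.mem_ker]
      change Submodule.factor hJann (Submodule.Quotient.mk a) = 0
      exact (Submodule.Quotient.mk_eq_zero _).2 ha
    have h3 : (⟨_, this⟩ : LinearMap.ker g) = 0 := Subsingleton.elim _ _
    have h4 := congrArg Subtype.val h3
    exact (Submodule.Quotient.mk_eq_zero _).1 h4
  refine ⟨?_, hann⟩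
  let ρ : R →ₗ[R] (M →ₗ[R] M) := Algebra.linearMap R (Module.End R M)
  have hker : LinearMap.ker ρ = J := by
    refine le_antisymm (fun a ha => hann ?_) (fun a ha => ?_)
    · rw [Module.mem_annihilator]
      intro m
      exact LinearMap.congr_fun (LinearMap.mem_ker.1 ha) m
    · rw [LinearMap.mem_ker]
      ext m
      exact hJM a ha m
  have hl1 : Module.length R (LinearMap.range ρ) = Module.length R M := by
    rw [← (ρ.quotKerEquivRange).length_eq, hker, a1]
  have h := Module.length_eq_add_of_exact (LinearMap.range ρ).subtype (LinearMap.range ρ).mkQ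
      (Submodule.subtype_injective _) (Submodule.mkQ_surjective _) (LinearMap.exact_subtype_mkQ _)
  rw [a3, hl1] at h
  have h0 : Module.length R ((M →ₗ[R] M) ⧸ LinearMap.range ρ) = 0 := by
    have : Module.length R M + 0 = Module.length R M +
        Module.length R ((M →ₗ[R] M) ⧸ LinearMap.range ρ) := by
      rw [add_zero]; exact h
    exact ((ENat.add_right_injective_of_ne_top a3') this).symm
  rw [Module.length_eq_zero_iff, Submodule.Quotient.subsingleton_iff] at h0
  intro φ
  have : φ ∈ LinearMap.range ρ := by rw [h0]; trivial
  obtain ⟨r, rfl⟩ := this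
  exact ⟨r, fun x => rfl⟩

end endo
end S13

namespace S13
section endo2
variable {R : Type u} [CommRing R]

lemma TT_step {M : Type u} [AddCommGroup M] [Module R M] (J : Ideal R) (n : ℕ) (x : R)
    (hx : Function.Injective (x • (LinearMap.id : M →ₗ[R] M))) (hT : TT R M J (n + 1)) :
    TT R (M ⧸ LinearMap.range (x • (LinearMap.id : M →ₗ[R] M))) (J ⊔ Ideal.span {x}) n := by
  intro N _ _ hN hJN
  have hxN : ∀ y : N, x • y = 0 :=
    hJN x (Ideal.mem_sup_right (Ideal.mem_span_singleton_self x))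
  obtain ⟨h1, h2⟩ := hT N hN (fun a ha => hJN a (Ideal.mem_sup_left ha))
  have hex := exact_smul_quot (M := M) x
  have hsu := Submodule.mkQ_surjective (LinearMap.range (x • (LinearMap.id : M →ₗ[R] M)))
  have key : ∀ i < n + 1, Function.Bijective (dV _ _ hx hsu hex i N) := by
    intro i hi
    have := h1 i hi
    constructor
    · rw [← LinearMap.ker_eq_bot, LinearMap.ker_eq_bot']
      intro y hy
      obtain ⟨z, rfl⟩ := (push_dV_exact _ _ hx hsu hex i y).1 hy
      rw [Subsingleton.elim z 0, map_zero]
    · intro y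
      refine (dV_push_exact _ _ hx hsu hex i y).1 ?_
      rw [push_smul_id]
      exact smul_E_zero hxN _ _
  refine ⟨fun i hi => ?_, ?_⟩
  · have := h1 (i + 1) (by omega)
    exact (key i (by omega)).1.subsingleton
  · rw [(LinearEquiv.ofBijective _ (key n (by omega))).length_eq, h2]

theorem endo_main [IsNoetherianRing R] [IsLocalRing R] (n : ℕ) :
    ∀ (M : Type u) [AddCommGroup M] [Module R M] [Module.Finite R M] (J : Ideal R),
    J ≤ maximalIdeal R →
    (∀ (p : Ideal R) (hp : p.IsPrime), J ≤ p →
      Order.coheight (⟨p, hp⟩ : PrimeSpectrum R) ≤ n) →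
    (∀ a ∈ J, ∀ x : M, a • x = 0) → TT R M J n →
    (∀ φ : M →ₗ[R] M, ∃ r : R, ∀ x, φ x = r • x) ∧ Module.annihilator R M ≤ J := by
  induction n with
  | zero =>
    intro M _ _ _ J hJm hD hJM hT
    refine endo_zero J ?_ hJM hT
    intro p hp hJp
    have h := hD p hp hJp
    by_contra hne
    have hlt : (⟨p, hp⟩ : PrimeSpectrum R) < ⟨maximalIdeal R, inferInstance⟩ :=
      lt_of_le_of_ne (le_maximalIdeal hp.ne_top) (fun h => hne (congrArg PrimeSpectrum.asIdeal h))
    have := (Order.coheight_add_one_le hlt).trans h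
    simp at this
  | succ n ih =>
    intro M _ _ _ J hJm hD hJM hT
    have hmass : ¬ IsAssociatedPrime (maximalIdeal R) M := by
      intro hp
      obtain ⟨f, hf⟩ := ((isAssociatedPrime_iff_exists_injective_linearMap _ M).1 hp).2
      have hfl : IsFiniteLength R (R ⧸ maximalIdeal R) := by
        rw [← Module.length_ne_top_iff]
        have : IsSimpleModule R (R ⧸ maximalIdeal R) := resField_simple
        rw [Module.length_eq_one_iff.2 this]; simp
      have h0 := (hT (R ⧸ maximalIdeal R) hfl (by
        intro a ha x
        rw [Algebra.smul_def]
        have : algebraMap R (R ⧸ maximalIdeal R) a = 0 := Ideal.Quotient.eq_zero_iff_mem.2 (hJm ha)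
        rw [this, zero_mul])).1 0 (by omega)
      have : f = 0 := (hom0 (R ⧸ maximalIdeal R) M).injective (Subsingleton.elim _ _)
      have h2 : (1 : R ⧸ maximalIdeal R) = 0 := hf (by simp [this])
      exact one_ne_zero h2
    obtain ⟨x, hxm, hxA, hxJ⟩ : ∃ x ∈ maximalIdeal R, (∀ p, IsAssociatedPrime p M → x ∉ p) ∧
        (∀ p ∈ J.minimalPrimes, p ≠ maximalIdeal R → x ∉ p) := by
      by_contra hcon
      push Not at hcon
      have hfin : (associatedPrimes R M ∪ (J.minimalPrimes \ {maximalIdeal R})).Finite :=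
        (associatedPrimes.finite R M).union
          ((Ideal.finite_minimalPrimes_of_isNoetherianRing R J).subset Set.sdiff_subset)
      have hsub : (maximalIdeal R : Set R) ⊆
          ⋃ i ∈ (associatedPrimes R M ∪ (J.minimalPrimes \ {maximalIdeal R})), (id i : Ideal R) := by
        intro x hx
        by_cases h : ∀ p, IsAssociatedPrime p M → x ∉ p
        · obtain ⟨p, h1, h2, h3⟩ := hcon x hx h
          exact Set.mem_biUnion (Or.inr ⟨h1, h2⟩) h3
        · push Not at h
          obtain ⟨p, h1, h3⟩ := h
          exact Set.mem_biUnion (Or.inl h1) h3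
      obtain ⟨p, hp, hle⟩ := (Ideal.subset_union_prime_finite hfin ⊥ ⊥ (by
        rintro i (hi | hi) _ _
        · exact hi.isPrime
        · exact hi.1.1.1)).1 hsub
      rcases hp with hp | hp
      · have : p = maximalIdeal R :=
          (le_antisymm hle (le_maximalIdeal (IsAssociatedPrime.isPrime hp).ne_top)).symm
        exact hmass (this ▸ hp)
      · exact hp.2 (le_antisymm (le_maximalIdeal hp.1.1.1.ne_top) hle)
    have hx : Function.Injective (x • (LinearMap.id : M →ₗ[R] M)) := by
      rw [← LinearMap.ker_eq_bot, LinearMap.ker_eq_bot']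
      intro m hm
      by_contra hne
      have : x ∈ ⋃ p ∈ associatedPrimes R M, (p : Set R) := by
        rw [biUnion_associatedPrimes_eq_zero_divisors]
        exact ⟨m, hne, hm⟩
      simp only [Set.mem_iUnion] at this
      obtain ⟨p, hp, hxp⟩ := this
      exact hxA p hp hxp
    have hT' := TT_step J n x hx hT
    have hJx : J ⊔ Ideal.span {x} ≤ maximalIdeal R :=
      sup_le hJm ((Ideal.span_singleton_le_iff_mem _).2 hxm)
    have hD' : ∀ (p : Ideal R) (hp : p.IsPrime), J ⊔ Ideal.span {x} ≤ p →
        Order.coheight (⟨p, hp⟩ : PrimeSpectrum R) ≤ n := by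
      intro q hq hle
      obtain ⟨p, hp, hpq⟩ := Ideal.exists_minimalPrimes_le (le_sup_left.trans hle : J ≤ q)
      have hpp : p.IsPrime := hp.1.1
      by_cases hpm : p = maximalIdeal R
      · have hqm : q = maximalIdeal R := le_antisymm (le_maximalIdeal hq.ne_top) (hpm ▸ hpq)
        have : Order.coheight (⟨q, hq⟩ : PrimeSpectrum R) = 0 := by
          rw [Order.coheight_eq_zero]
          intro b _
          change b.asIdeal ≤ q
          rw [hqm]
          exact le_maximalIdeal b.2.ne_top
        rw [this]
        exact zero_le
      · have hxp := hxJ p hp hpm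
        have hlt : (⟨p, hpp⟩ : PrimeSpectrum R) < ⟨q, hq⟩ := by
          refine lt_of_le_of_ne hpq ?_
          intro h
          apply hxp
          have h' : p = q := congrArg PrimeSpectrum.asIdeal h
          rw [h']
          exact hle (Ideal.mem_sup_right (Ideal.mem_span_singleton_self x))
        have h1 := (Order.coheight_add_one_le hlt).trans (hD p hpp hp.1.2)
        push_cast at h1
        exact (ENat.add_le_add_iff_right ENat.one_ne_top).1 h1
    have hJM' : ∀ a ∈ J ⊔ Ideal.span {x},
        ∀ y : M ⧸ LinearMap.range (x • (LinearMap.id : M →ₗ[R] M)), a • y = 0 := by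
      intro a ha y
      induction y using Submodule.Quotient.induction_on with | _ y =>
      obtain ⟨b, hb, c, hc, rfl⟩ := Submodule.mem_sup.1 ha
      obtain ⟨c, rfl⟩ := Ideal.mem_span_singleton'.1 hc
      rw [← Submodule.Quotient.mk_smul, Submodule.Quotient.mk_eq_zero]
      refine ⟨c • y, ?_⟩
      rw [add_smul, hJM b hb, zero_add, mul_comm, mul_smul]
      rfl
    obtain ⟨r1, r2⟩ := ih (M ⧸ LinearMap.range (x • (LinearMap.id : M →ₗ[R] M)))
      (J ⊔ Ideal.span {x}) hJx hD' hJM' hT'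
    · constructor
      · have key : ∀ φ : M →ₗ[R] M, ∃ r : R, ∃ ψ : M →ₗ[R] M, φ = r • LinearMap.id + x • ψ := by
          intro φ
          have hmap : LinearMap.range (x • (LinearMap.id : M →ₗ[R] M)) ≤
              (LinearMap.range (x • (LinearMap.id : M →ₗ[R] M))).comap φ := by
            rintro _ ⟨z, rfl⟩
            exact ⟨φ z, by simp⟩
          obtain ⟨r, hr⟩ := r1 (Submodule.mapQ _ _ φ hmap)
          refine ⟨r, ?_⟩
          have hmem : ∀ y, (φ - r • (LinearMap.id : M →ₗ[R] M)) y ∈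
              LinearMap.range (x • (LinearMap.id : M →ₗ[R] M)) := by
            intro y
            have h1 := hr (Submodule.Quotient.mk y)
            rw [Submodule.mapQ_apply, ← Submodule.Quotient.mk_smul, Submodule.Quotient.eq] at h1
            exact h1
          let e := LinearEquiv.ofInjective _ hx
          refine ⟨e.symm.toLinearMap ∘ₗ LinearMap.codRestrict _ (φ - r • LinearMap.id) hmem, ?_⟩
          ext y
          have h2 := congrArg Subtype.val
            (e.apply_symm_apply (LinearMap.codRestrict _ (φ - r • LinearMap.id) hmem y))
          have h3 : x • (e.symm (LinearMap.codRestrict _ (φ - r • LinearMap.id) hmem y)) =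
            φ y - r • y := h2
          simp only [LinearMap.add_apply, LinearMap.smul_apply, LinearMap.id_apply,
            LinearMap.comp_apply, LinearEquiv.coe_coe]
          rw [h3]; abel
        let ρ : R →ₗ[R] (M →ₗ[R] M) := Algebra.linearMap R (Module.End R M)
        have hs : Subsingleton ((M →ₗ[R] M) ⧸ LinearMap.range ρ) := by
          apply nakayama_smul hxm
          intro y
          induction y using Submodule.Quotient.induction_on with | _ φ =>
          obtain ⟨r, ψ, h⟩ := key φ
          refine ⟨Submodule.Quotient.mk ψ, ?_⟩
          rw [← Submodule.Quotient.mk_smul, Submodule.Quotient.eq]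
          refine ⟨r, ?_⟩
          rw [h]
          ext y
          simp [ρ]
        rw [Submodule.Quotient.subsingleton_iff] at hs
        intro φ
        have : φ ∈ LinearMap.range ρ := by rw [hs]; trivial
        obtain ⟨r, rfl⟩ := this
        exact ⟨r, fun x => rfl⟩
      · refine Submodule.le_of_le_smul_of_le_jacobson_bot (I := maximalIdeal R)
          (IsNoetherian.noetherian _) (IsLocalRing.jacobson_eq_maximalIdeal ⊥ bot_ne_top).ge ?_
        intro a ha
        have ha' := Module.mem_annihilator.1 ha
        have : a ∈ J ⊔ Ideal.span {x} := by
          apply r2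
          rw [Module.mem_annihilator]
          intro y
          induction y using Submodule.Quotient.induction_on with | _ y =>
          rw [← Submodule.Quotient.mk_smul, ha' y, Submodule.Quotient.mk_zero]
        obtain ⟨b, hb, c, hc, rfl⟩ := Submodule.mem_sup.1 this
        obtain ⟨c, rfl⟩ := Ideal.mem_span_singleton'.1 hc
        refine Submodule.add_mem_sup hb ?_
        rw [mul_comm]
        refine Submodule.smul_mem_smul hxm ?_
        rw [Module.mem_annihilator]
        intro y
        apply hx
        have h1 := ha' y
        rw [add_smul, hJM b hb, zero_add, mul_comm, mul_smul] at h1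
        rw [map_zero]
        exact h1

theorem F1 [IsNoetherianRing R] [IsLocalRing R] (d : ℕ) (hdim : ringKrullDim R = d)
    (M : Type u) [AddCommGroup M] [Module R M] [Module.Finite R M]
    (h1 : ∀ i, i ≠ d → Subsingleton (E R i (ResidueField R) M))
    (h2 : Nonempty (E R d (ResidueField R) M ≃ₗ[R] ResidueField R)) :
    (∀ φ : M →ₗ[R] M, ∃ r : R, ∀ x, φ x = r • x) ∧ (∀ a : R, (∀ x : M, a • x = 0) → a = 0) := by
  obtain ⟨r1, r2⟩ := endo_main d M ⊥ bot_le (by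
      intro p hp _
      have h4 : ((Order.coheight (⟨p, hp⟩ : PrimeSpectrum R) : ℕ∞) : WithBot ℕ∞) ≤ d :=
        (Order.coheight_le_krullDim _).trans hdim.le
      exact_mod_cast h4) (by
      intro a ha x
      rw [(Submodule.mem_bot R).1 ha, zero_smul]) (by
      intro N _ _ hN _
      obtain ⟨a1, a2⟩ := TT_canonical d h1 h2 N hN
      exact ⟨fun i hi => a1 i (by omega), a2⟩)
  exact ⟨r1, fun a ha => (Submodule.mem_bot R).1 (r2 (Module.mem_annihilator.2 ha))⟩

end endo2
end S13

namespace S13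
section generic
variable {R : Type u} [CommRing R]

lemma canon_E [IsLocalRing R] {d : ℕ} {ω : Type u} [AddCommGroup ω] [Module R ω]
    (h : IsCanonicalModule R d ω) : Module.Finite R ω ∧
    (∀ i, i ≠ d → Subsingleton (E R i (ResidueField R) ω)) ∧
    Nonempty (E R d (ResidueField R) ω ≃ₗ[R] ResidueField R) := by
  obtain ⟨h1, h2, ⟨e⟩⟩ := h
  refine ⟨h1, fun i hi => ?_, ⟨(extEquiv R d (ResidueField R) ω).symm.trans e⟩⟩
  have := h2 i hi
  exact (extEquiv R i (ResidueField R) ω).symm.toEquiv.subsingleton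

/-- Zero-dimensional Gorenstein: faithful modules have a free summand. -/
lemma gor_zero {A : Type u} [CommRing A] [IsNoetherianRing A] [IsLocalRing A]
    (hA : ∀ p : Ideal A, p.IsPrime → p = maximalIdeal A) (hG : IsCanonicalModule A 0 A)
    (W : Type u) [AddCommGroup W] [Module A W] [Module.Finite A W]
    (hW : ∀ a : A, (∀ w : W, a • w = 0) → a = 0) : ∃ (z : W) (π : W →ₗ[A] A), π z = 1 := by
  obtain ⟨-, h1, ⟨e⟩⟩ := canon_E hG
  let e' := (hom0 (R := A) (ResidueField A) A).trans e
  let f := e'.symm 1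
  have hf : f ≠ 0 := by simp [f]
  let σ : A := f 1
  have hσ : σ ≠ 0 := by
    intro h0
    apply hf
    apply LinearMap.ext
    intro x
    obtain ⟨a, rfl⟩ := Ideal.Quotient.mk_surjective x
    have : Ideal.Quotient.mk (maximalIdeal A) a = a • (1 : A ⧸ maximalIdeal A) := by
      rw [Algebra.smul_def, mul_one]; rfl
    rw [this]
    change f (a • (1 : ResidueField A)) = 0
    rw [map_smul]
    change a • σ = 0
    rw [h0, smul_zero]
  have hmσ : ∀ a ∈ maximalIdeal A, a * σ = 0 := by
    intro a ha
    have : a • (1 : ResidueField A) = 0 := by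
      rw [Algebra.smul_def, mul_one]
      exact Ideal.Quotient.eq_zero_iff_mem.2 ha
    change a • f 1 = 0
    rw [← map_smul, this, map_zero]
  have hsoc : ∀ τ : A, (∀ a ∈ maximalIdeal A, a * τ = 0) → ∃ c, τ = c * σ := by
    intro τ hτ
    let g : ResidueField A →ₗ[A] A := Submodule.liftQ (maximalIdeal A)
      (LinearMap.toSpanSingleton A A τ) (fun a ha => by simpa using hτ a ha)
    have hg : g 1 = τ := by
      change Submodule.liftQ (maximalIdeal A) (LinearMap.toSpanSingleton A A τ) _
        (Submodule.Quotient.mk 1) = τ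
      rw [Submodule.liftQ_apply]; simp
    obtain ⟨c, hc⟩ := Ideal.Quotient.mk_surjective (e' g)
    have h2 : e' g = e' (c • f) := by
      rw [map_smul, e'.apply_symm_apply, Algebra.smul_def, mul_one, ← hc]; rfl
    have h3 := e'.injective h2
    refine ⟨c, ?_⟩
    rw [← hg, h3]
    rfl
  obtain ⟨z, hz⟩ : ∃ z : W, σ • z ≠ 0 := by
    by_contra hcon
    push Not at hcon
    exact hσ (hW σ hcon)
  let ι : A →ₗ[A] W := LinearMap.toSpanSingleton A W z
  have hι : Function.Injective ι := by
    rw [← LinearMap.ker_eq_bot]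
    by_contra hne
    have : Nontrivial (LinearMap.ker ι) := Submodule.nontrivial_iff_ne_bot.2 hne
    obtain ⟨P, hP⟩ := associatedPrimes.nonempty A (LinearMap.ker ι)
    have hPm := hA P hP.isPrime
    obtain ⟨_, τ, hτ⟩ := isAssociatedPrime_iff.1 hP
    have hτ0 : (τ : A) ≠ 0 := by
      intro h0
      have h0' : τ = 0 := Subtype.ext h0
      apply hP.isPrime.ne_top
      rw [hτ, h0']
      rw [Ideal.eq_top_iff_one, Submodule.mem_colon_singleton]
      simp
    have hmτ : ∀ a ∈ maximalIdeal A, a * (τ : A) = 0 := by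
      intro a ha
      rw [← hPm, hτ, Submodule.mem_colon_singleton] at ha
      exact congrArg Subtype.val ((Submodule.mem_bot A).1 ha)
    obtain ⟨c, hc⟩ := hsoc τ hmτ
    have hcu : IsUnit c := by
      by_contra hcu
      exact hτ0 (by rw [hc, hmσ c ((mem_maximalIdeal c).2 hcu)])
    have hτz : (τ : A) • z = 0 := τ.2
    rw [hc, mul_smul] at hτz
    exact hz (by simpa using (hcu.smul_eq_zero).1 hτz)
  have h10 : Subsingleton (E A 1 (W ⧸ LinearMap.range ι) A) := F0 0 h1 1 (by omega)
  obtain ⟨y, hy⟩ := (pull_dC_exact (N := A) ι (LinearMap.range ι).mkQ hι (Submodule.mkQ_surjective _)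
    (LinearMap.exact_map_mkQ_range ι) 0 (hom0 A A LinearMap.id)).1 (Subsingleton.elim _ _)
  obtain ⟨π, rfl⟩ := (hom0 _ _).surjective y
  rw [pull_hom0, EmbeddingLike.apply_eq_iff_eq] at hy
  refine ⟨z, π, ?_⟩
  have := LinearMap.congr_fun hy 1
  simpa [ι] using this

lemma generic_cyclic [IsNoetherianRing R] (ω : Type u) [AddCommGroup ω] [Module R ω]
    [Module.Finite R ω] (hend : ∀ φ : ω →ₗ[R] ω, ∃ r : R, ∀ x, φ x = r • x)
    (hfaith : ∀ a : R, (∀ x : ω, a • x = 0) → a = 0)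
    (p : Ideal R) (hp : p.IsPrime) (hmin : p ∈ minimalPrimes R)
    (hG : IsGorensteinLocal (Localization.AtPrime p)) :
    ∃ e : ω, ∀ y : ω, ∃ s ∉ p, ∃ r : R, s • y = r • e := by
  obtain ⟨hNoeth, d, hd, hcan⟩ := hG
  have hdim : ringKrullDim (Localization.AtPrime p) = 0 := by
    rw [IsLocalization.AtPrime.ringKrullDim_eq_height p, (Ideal.height_eq_zero_iff).2 hmin]
    rfl
  have hd0 : d = 0 := by
    rw [hdim] at hd
    exact_mod_cast hd.symm
  subst hd0
  have hA : ∀ q : Ideal (Localization.AtPrime p), q.IsPrime →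
      q = maximalIdeal (Localization.AtPrime p) := by
    have := ringKrullDimZero_iff_ringKrullDim_eq_zero.2 hdim
    intro q hq
    exact IsLocalRing.eq_maximalIdeal (Ring.krullDimLE_zero_iff.1 this q hq)
  let W := LocalizedModule p.primeCompl ω
  let mk : ω →ₗ[R] W := LocalizedModule.mkLinearMap p.primeCompl ω
  have hmk : ∀ {x y : ω}, mk x = mk y ↔ ∃ c : p.primeCompl, c • x = c • y :=
    IsLocalizedModule.eq_iff_exists p.primeCompl mk
  have hW : ∀ a : Localization.AtPrime p, (∀ w : W, a • w = 0) → a = 0 := by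
    intro a ha
    obtain ⟨⟨r, s⟩, rfl⟩ := IsLocalization.mk'_surjective p.primeCompl a
    have h1 : ∀ x : ω, ∃ c ∈ p.primeCompl, c • (r • x) = 0 := by
      intro x
      have h2 : mk (r • x) = mk 0 := by
        rw [map_zero, map_smul, ← algebraMap_smul (Localization.AtPrime p) r,
          ← IsLocalization.mk'_spec (Localization.AtPrime p) r s, mul_comm, mul_smul, ha, smul_zero]
      obtain ⟨c, hc⟩ := hmk.1 h2
      exact ⟨c, c.2, by rw [smul_zero] at hc; exact hc⟩
    obtain ⟨G, hG⟩ := (Module.Finite.fg_top : (⊤ : Submodule R ω).FG)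
    choose c hc hc0 using h1
    have hcr : (∏ g ∈ G, c g) * r = 0 := by
      apply hfaith
      have : LinearMap.ker (((∏ g ∈ G, c g) * r) • (LinearMap.id : ω →ₗ[R] ω)) = ⊤ := by
        rw [eq_top_iff, ← hG, Submodule.span_le]
        intro g hg
        change ((∏ g ∈ G, c g) * r) • g = 0
        obtain ⟨b, hb⟩ := Finset.dvd_prod_of_mem c hg
        rw [hb, mul_comm (c g), mul_assoc, mul_smul, mul_smul, hc0, smul_zero]
      intro x
      have hx : x ∈ LinearMap.ker (((∏ g ∈ G, c g) * r) • (LinearMap.id : ω →ₗ[R] ω)) := by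
        rw [this]; trivial
      exact hx
    rw [IsLocalization.mk'_eq_zero_iff]
    exact ⟨⟨∏ g ∈ G, c g, prod_mem fun g _ => hc g⟩, hcr⟩
  obtain ⟨z, π, hπ⟩ := gor_zero hA hcan W hW
  let θ : W →ₗ[R] W :=
    ((LinearMap.toSpanSingleton (Localization.AtPrime p) W z) ∘ₗ π).restrictScalars R
  have hθ : ∀ w, θ w = π w • z := fun w => rfl
  have : Module.FinitePresentation R ω := Module.finitePresentation_of_finite R ω
  obtain ⟨φ, s, hφ⟩ := Module.FinitePresentation.exists_lift_of_isLocalizedModule p.primeCompl mk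
    (θ ∘ₗ mk)
  obtain ⟨r, hr⟩ := hend φ
  have h1 : ∀ y : ω, r • mk y = (s : R) • θ (mk y) := by
    intro y
    have := LinearMap.congr_fun hφ y
    rw [LinearMap.comp_apply, hr, map_smul] at this
    exact this
  have unit_smul : ∀ (t : p.primeCompl) (w w' : W), (t : R) • w = (t : R) • w' → w = w' := by
    intro t w w' h
    have := (Module.End.isUnit_iff _).1 (IsLocalizedModule.map_units mk t)
    exact this.1 h
  obtain ⟨⟨e, t⟩, hzt⟩ := IsLocalizedModule.surj p.primeCompl mk z
  have hzt : (t : R) • z = mk e := hzt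
  have h2 : ∀ y : ω, mk y = π (mk y) • z := by
    have h3 : r • z = (s : R) • z := by
      apply unit_smul t
      rw [smul_comm, hzt, h1, ← hzt, map_smul, smul_comm, hθ, hπ, one_smul]
    have h4 : algebraMap R (Localization.AtPrime p) r = algebraMap R (Localization.AtPrime p) s := by
      have h5 := congrArg π h3
      rw [← algebraMap_smul (Localization.AtPrime p) r,
        ← algebraMap_smul (Localization.AtPrime p) (s : R) z, map_smul, map_smul, hπ] at h5
      simpa using h5
    intro y
    apply unit_smul s
    have h6 := h1 y
    rw [← algebraMap_smul (Localization.AtPrime p) r, h4, algebraMap_smul] at h6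
    exact h6
  refine ⟨e, fun y => ?_⟩
  obtain ⟨⟨a, b⟩, hab⟩ := IsLocalization.mk'_surjective p.primeCompl (π (mk y))
  have h7 : mk (((b : R) * t) • y) = mk (a • e) := by
    rw [map_smul, h2 y, ← hab, map_smul, ← hzt, mul_comm, mul_smul, smul_comm a]
    congr 1
    rw [← algebraMap_smul (Localization.AtPrime p) (b : R), ← mul_smul, mul_comm,
      IsLocalization.mk'_spec, algebraMap_smul]
  obtain ⟨c, hc⟩ := hmk.1 h7
  refine ⟨(c : R) * (b * t), (c * (b * t)).2, (c : R) * a, ?_⟩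
  rw [mul_smul, mul_smul (c : R) a]
  exact hc

theorem goalA [IsNoetherianRing R] [IsLocalRing R] (d : ℕ) (hdim : ringKrullDim R = d)
    (ω : Type u) [AddCommGroup ω] [Module R ω] [Module.Finite R ω]
    (h1 : ∀ i, i ≠ d → Subsingleton (E R i (ResidueField R) ω))
    (hend : ∀ φ : ω →ₗ[R] ω, ∃ r : R, ∀ x, φ x = r • x)
    (hfaith : ∀ a : R, (∀ x : ω, a • x = 0) → a = 0)
    (hgen : ∀ (p : Ideal R) (hp : p.IsPrime), p ∈ minimalPrimes R →
      IsGorensteinLocal (Localization.AtPrime p))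
    (f : ω →ₗ[R] R) (x y : ω) : f y • x = f x • y := by
  by_contra hne
  have ht : f y • x - f x • y ≠ 0 := sub_ne_zero.2 hne
  obtain ⟨P, hP, hle⟩ := exists_le_isAssociatedPrime_of_isNoetherianRing R _ ht
  have hmin := F2 d hdim h1 P hP
  obtain ⟨e, he⟩ := generic_cyclic ω hend hfaith P hP.isPrime hmin (hgen P hP.isPrime hmin)
  obtain ⟨s1, hs1, r1, h2⟩ := he x
  obtain ⟨s2, hs2, r2, h3⟩ := he y
  have hmem : s1 * s2 ∈ P := by
    apply hle
    rw [Submodule.mem_colon_singleton, Submodule.mem_bot]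
    have e1 : (s1 * s2) • (f y • x) = (f (s2 • y)) • (s1 • x) := by
      rw [map_smul, smul_eq_mul, smul_smul, smul_smul]; ring_nf
    have e2 : (s1 * s2) • (f x • y) = (f (s1 • x)) • (s2 • y) := by
      rw [map_smul, smul_eq_mul, smul_smul, smul_smul]; ring_nf
    rw [smul_sub, e1, e2, h2, h3, map_smul, map_smul, smul_smul, smul_smul, smul_eq_mul,
      smul_eq_mul, ← sub_smul]
    ring_nf
    rw [zero_smul]
  rcases hP.isPrime.mem_or_mem hmem with h | h
  · exact hs1 h
  · exact hs2 h

end generic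
end S13

namespace S13
section f3
variable {R : Type u} [CommRing R]

section abs
variable {A B C N : Type u} [AddCommGroup A] [Module R A] [AddCommGroup B] [Module R B]
  [AddCommGroup C] [Module R C] [AddCommGroup N] [Module R N] (f : A →ₗ[R] B) (g : B →ₗ[R] C)

lemma abs_kill (hf : Function.Injective f) (hg : Function.Surjective g)
    (hfg : ∀ y, g y = 0 ↔ ∃ x, f x = y) [Module.Free R B] (n : ℕ) (b : R)
    (hk : ∀ x : E R (n + 1 + 1) C N, b • x = 0) (x : E R (n + 1) A N) : b • x = 0 := by
  have h1 : dC f g hf hg hfg (n + 1) N (b • x) = 0 := by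
    rw [map_smul]; exact hk _
  obtain ⟨y, hy⟩ := (pull_dC_exact f g hf hg hfg (n + 1) _).1 h1
  rw [← hy, Subsingleton.elim y 0, map_zero]

lemma abs_descend (hf : Function.Injective f) (hg : Function.Surjective g)
    (hfg : ∀ y, g y = 0 ↔ ∃ x, f x = y) (u : B →ₗ[R] N) (hu : u ∘ₗ f = 0) :
    ∃ φ : C →ₗ[R] N, φ ∘ₗ g = u := by
  have h1 : pull 0 N f (hom0 _ N u) = 0 := by
    rw [pull_hom0, hu, map_zero]
  obtain ⟨z, hz⟩ := (pull_exact f g hf hg hfg 0 _).1 h1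
  obtain ⟨φ, rfl⟩ := (hom0 _ _).surjective z
  rw [pull_hom0, EmbeddingLike.apply_eq_iff_eq] at hz
  exact ⟨φ, hz⟩

lemma abs_extend (hf : Function.Injective f) (hg : Function.Surjective g)
    (hfg : ∀ y, g y = 0 ↔ ∃ x, f x = y) (b : R) (hk : ∀ x : E R 1 C N, b • x = 0)
    (ψ : A →ₗ[R] N) : ∃ φ : B →ₗ[R] N, φ ∘ₗ f = b • ψ := by
  have h1 : dC f g hf hg hfg 0 N (hom0 _ N (b • ψ)) = 0 := by
    rw [map_smul, map_smul]; exact hk _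
  obtain ⟨z, hz⟩ := (pull_dC_exact f g hf hg hfg 0 _).1 h1
  obtain ⟨φ, rfl⟩ := (hom0 _ _).surjective z
  rw [pull_hom0, EmbeddingLike.apply_eq_iff_eq] at hz
  exact ⟨φ, hz⟩
end abs

section dual
variable {M F : Type u} [AddCommGroup M] [Module R M] [AddCommGroup F] [Module R F]
  (π : F →ₗ[R] M)

/-- Restriction of functionals to the kernel. -/
abbrev rst : (F →ₗ[R] R) →ₗ[R] (LinearMap.ker π →ₗ[R] R) :=
  LinearMap.lcomp R R (LinearMap.ker π).subtype

/-- The image of the restriction map. -/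
abbrev Bd : Submodule R (LinearMap.ker π →ₗ[R] R) := LinearMap.range (rst π)

/-- Restriction onto its image. -/
noncomputable def rr : (F →ₗ[R] R) →ₗ[R] Bd π := (rst π).rangeRestrict

lemma rr_surj : Function.Surjective (rr π) := LinearMap.surjective_rangeRestrict (rst π)

lemma dual_inj (hπ : Function.Surjective π) :
    Function.Injective (LinearMap.lcomp R R π) := by
  intro f g h
  ext z
  obtain ⟨z, rfl⟩ := hπ z
  exact LinearMap.congr_fun h z

lemma dual_exact (hπ : Function.Surjective π) :
    Function.Exact (LinearMap.lcomp R R π) (rr π) := by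
  intro φ
  constructor
  · intro h
    have h0 : rst π φ = 0 := congrArg Subtype.val h
    have h1 : pull 0 R (LinearMap.ker π).subtype (hom0 F R φ) = 0 := by
      rw [pull_hom0, ← map_zero (hom0 _ _)]
      exact congrArg _ h0
    obtain ⟨y, hy⟩ := (pull_exact (N := R) (LinearMap.ker π).subtype π
      (Submodule.subtype_injective _) hπ (LinearMap.exact_subtype_ker_map π) 0 _).1 h1
    obtain ⟨f, rfl⟩ := (hom0 _ _).surjective y
    rw [pull_hom0, EmbeddingLike.apply_eq_iff_eq] at hy
    exact ⟨f, hy⟩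
  · rintro ⟨f, rfl⟩
    apply Subtype.ext
    ext x
    have : π x = 0 := x.2
    change f (π x) = 0
    rw [this, map_zero]

lemma smul_mem_range (hπ : Function.Surjective π) (a : R)
    (ha : ∀ x : E R 1 M R, a • x = 0) (ψ : LinearMap.ker π →ₗ[R] R) :
    a • ψ ∈ Bd π := by
  have hex := LinearMap.exact_subtype_ker_map π
  have hi := Submodule.subtype_injective (LinearMap.ker π)
  have h1 : dC _ _ hi hπ hex 0 R (hom0 _ R (a • ψ)) = 0 := by
    rw [map_smul, map_smul]; exact ha _
  obtain ⟨y, hy⟩ := (pull_dC_exact _ _ hi hπ hex 0 _).1 h1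
  obtain ⟨f, rfl⟩ := (hom0 _ _).surjective y
  rw [pull_hom0, EmbeddingLike.apply_eq_iff_eq] at hy
  exact ⟨f, hy⟩

lemma ker_kill [Module.Free R F] (hπ : Function.Surjective π) (a : R)
    (ha : ∀ i, ∀ x : E R (i + 1) M R, a • x = 0) (i : ℕ) (x : E R (i + 1) (LinearMap.ker π) R) :
    a • x = 0 := by
  have hex := LinearMap.exact_subtype_ker_map π
  have hi := Submodule.subtype_injective (LinearMap.ker π)
  have h1 : dC _ _ hi hπ hex (i + 1) R (a • x) = 0 := by
    rw [map_smul]; exact ha _ _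
  obtain ⟨y, hy⟩ := (pull_dC_exact _ _ hi hπ hex (i + 1) _).1 h1
  rw [← hy, Subsingleton.elim y 0, map_zero]

/-- Multiplication by `a` into the range. -/
noncomputable def mulR (a : R)
    (h : ∀ ψ : LinearMap.ker π →ₗ[R] R, a • ψ ∈ Bd π) :
    (LinearMap.ker π →ₗ[R] R) →ₗ[R] Bd π :=
  LinearMap.codRestrict _ (a • LinearMap.id) h

lemma range_kill (hπ : Function.Surjective π) (a : R)
    (ha : ∀ x : E R 1 M R, a • x = 0) {ω : Type u} [AddCommGroup ω] [Module R ω] (n N : ℕ)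
    (hN : ∀ x : E R n (LinearMap.ker π →ₗ[R] R) ω, a ^ N • x = 0)
    (x : E R n (Bd π) ω) : a ^ (N + 1) • x = 0 := by
  have h := smul_mem_range π hπ a ha
  have hc : mulR π a h ∘ₗ (Bd π).subtype = a • LinearMap.id := by
    ext; rfl
  rw [pow_succ, mul_smul, ← pull_smul_id n a x, ← hc, pull_comp, ← map_smul, hN, map_zero]

end dual

lemma exists_fin_cover (M : Type u) [AddCommGroup M] [Module R M] [Module.Finite R M] :
    ∃ (m : ℕ) (π : (Fin m → R) →ₗ[R] M), Function.Surjective π :=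
  Module.Finite.exists_fin' R M

theorem QQ [IsNoetherianRing R] (d : ℕ) (ω : Type u) [AddCommGroup ω] [Module R ω]
    (hF0 : ∀ (M : Type u) [AddCommGroup M] [Module R M] [Module.Finite R M],
      Subsingleton (E R (d + 1) M ω)) (a : R) (k : ℕ) :
    ∀ n, n + 1 + k = d + 1 → ∀ (M : Type u) [AddCommGroup M] [Module R M] [Module.Finite R M],
      (∀ i, ∀ x : E R (i + 1) M R, a • x = 0) →
      ∃ N, ∀ x : E R (n + 1) (M →ₗ[R] R) ω, a ^ N • x = 0 := by
  induction k with
  | zero =>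
    intro n hn M _ _ _ _
    obtain rfl : n = d := by omega
    have := hF0 (M →ₗ[R] R)
    exact ⟨0, fun x => Subsingleton.elim _ _⟩
  | succ k ih =>
    intro n hn M _ _ _ hM
    obtain ⟨m, π, hπ⟩ := exists_fin_cover (R := R) M
    obtain ⟨N, hN⟩ := ih (n + 1) (by omega) (LinearMap.ker π) (ker_kill π hπ a hM)
    refine ⟨N + 1, fun x => ?_⟩
    have hk := range_kill π hπ a (hM 0) (n + 1 + 1) N hN
    have hi := dual_inj π hπ
    have hs := rr_surj π
    have hex := dual_exact π hπ
    exact abs_kill (LinearMap.lcomp R R π) (rr π) hi hs (fun y => hex y) n _ hk x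

theorem rank_one_relation [IsNoetherianRing R] (d : ℕ) (ω : Type u) [AddCommGroup ω] [Module R ω]
    [Module.Finite R ω]
    (hF0 : ∀ (M : Type u) [AddCommGroup M] [Module R M] [Module.Finite R M] (i : ℕ), d < i →
      Subsingleton (E R i M ω))
    (hA : ∀ (f : ω →ₗ[R] R) (x y : ω), f y • x = f x • y) (a : R)
    (ha : ∀ i, ∀ x : E R (i + 1) ω R, a • x = 0) (x y : ω) :
    ∃ N : ℕ, ∀ (K : Type u) [CommRing K] [Algebra R K] (l μ : ω →ₗ[R] K),
      a ^ N • (l y * μ x - l x * μ y) = 0 := by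
  obtain ⟨n, g, hg⟩ := exists_fin_cover (R := R) ω
  obtain ⟨X, hX⟩ := hg x
  obtain ⟨Y, hY⟩ := hg y
  obtain ⟨m, h, hh⟩ := exists_fin_cover (R := R) (LinearMap.ker g)
  have hk1 := ker_kill g hg a ha
  have hk2 := ker_kill h hh a hk1
  obtain ⟨N, hN⟩ : ∃ N, ∀ x : E R (0 + 1) (LinearMap.ker h →ₗ[R] R) ω, a ^ N • x = 0 := by
    refine QQ (d + 0) ω (fun M _ _ _ => hF0 M (d + 1) (by omega)) a d 0 (by omega) _ hk2
  have hB2 := range_kill h hh a (hk1 0) 1 N hN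
  -- the map on functionals
  let φu : ((Fin n → R) →ₗ[R] R) →ₗ[R] ω :=
    LinearMap.toSpanSingleton R ω x ∘ₗ LinearMap.applyₗ Y -
      LinearMap.toSpanSingleton R ω y ∘ₗ LinearMap.applyₗ X
  have hφu : ∀ c, φu c = c Y • x - c X • y := fun c => rfl
  -- descend
  have hi := dual_inj g hg
  have hs := rr_surj g
  have hex := dual_exact g hg
  obtain ⟨φ, hφ⟩ : ∃ φ : Bd g →ₗ[R] ω, φ ∘ₗ rr g = φu := by
    have h0 := abs_descend (C := Bd g) (N := ω) (LinearMap.lcomp R R g) (rr g) hi hs (fun y => hex y) φu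
    refine h0 ?_
    apply LinearMap.ext
    intro f
    rw [LinearMap.comp_apply, hφu]
    simp only [LinearMap.lcomp_apply, hX, hY]
    rw [hA f x y, sub_self]; rfl
  have hsm := smul_mem_range g hg a (ha 0)
  let ψ : (LinearMap.ker g →ₗ[R] R) →ₗ[R] ω := φ ∘ₗ mulR g a hsm
  have hψ : ∀ c : (Fin n → R) →ₗ[R] R, ψ (rst g c) = a • φu c := by
    intro c
    rw [← hφ, LinearMap.comp_apply, ← map_smul]
    rfl
  -- extend
  have hi2 := dual_inj h hh
  have hs2 := rr_surj h
  have hex2 := dual_exact h hh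
  obtain ⟨Ψ, hΨ⟩ : ∃ Ψ : ((Fin m → R) →ₗ[R] R) →ₗ[R] ω,
      Ψ ∘ₗ LinearMap.lcomp R R h = a ^ (N + 1) • ψ := by
    exact abs_extend (LinearMap.lcomp R R h) (rr h) hi2 hs2 (fun y => hex2 y) _ hB2 ψ
  have key : ∀ c : (Fin n → R) →ₗ[R] R, a ^ (N + 2) • (c Y • x - c X • y) =
      ∑ q : Fin m, c (h (Pi.single q 1)) • Ψ (LinearMap.proj q) := by
    intro c
    have h1 := LinearMap.congr_fun hΨ (rst g c)
    rw [LinearMap.comp_apply, LinearMap.smul_apply, hψ, hφu, smul_smul, ← pow_succ] at h1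
    rw [← h1]
    have h2 : LinearMap.lcomp R R h (rst g c) =
        ∑ q : Fin m, c (h (Pi.single q 1)) • (LinearMap.proj q : (Fin m → R) →ₗ[R] R) := by
      apply LinearMap.pi_ext'
      intro q
      ext
      simp [Pi.single_apply]
    rw [h2, map_sum]
    simp_rw [map_smul]
  refine ⟨N + 2, fun K _ _ l μ => ?_⟩
  have expand : ∀ Z : Fin n → R, l (g Z) = ∑ k, Z k • l (g (Pi.single k 1)) := by
    intro Z
    conv_lhs => rw [pi_eq_sum_univ' Z]
    rw [map_sum, map_sum]
    refine Finset.sum_congr rfl fun k _ => ?_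
    rw [map_smul, map_smul]
  have e1 : ∀ k : Fin n, a ^ (N + 2) • (Y k • μ x - X k • μ y) =
      ∑ q : Fin m, (h (Pi.single q 1) : Fin n → R) k • μ (Ψ (LinearMap.proj q)) := by
    intro k
    have h1 := congrArg μ (key (LinearMap.proj k))
    simpa only [map_smul, map_sub, map_sum, LinearMap.proj_apply] using h1
  have e2 : ∑ k : Fin n, (a ^ (N + 2) • (Y k • μ x - X k • μ y)) * l (g (Pi.single k 1)) =
      a ^ (N + 2) • (l y * μ x - l x * μ y) := by
    rw [← hX, ← hY, expand X, expand Y, Finset.sum_mul, Finset.sum_mul, ← Finset.sum_sub_distrib,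
      Finset.smul_sum]
    refine Finset.sum_congr rfl fun k _ => ?_
    simp only [Algebra.smul_def]
    ring
  rw [← e2]
  simp_rw [e1, Finset.sum_mul]
  rw [Finset.sum_comm]
  refine Finset.sum_eq_zero fun q _ => ?_
  have e3 : l (g (h (Pi.single q 1) : Fin n → R)) = 0 := by
    have : g (h (Pi.single q 1) : Fin n → R) = 0 := (h (Pi.single q 1)).2
    rw [this, map_zero]
  rw [expand] at e3
  calc _ = (∑ k, (h (Pi.single q 1) : Fin n → R) k • l (g (Pi.single k 1))) *
        μ (Ψ (LinearMap.proj q)) := by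
        rw [Finset.sum_mul]
        refine Finset.sum_congr rfl fun k _ => ?_
        simp only [Algebra.smul_def]
        ring
    _ = 0 := by rw [e3, zero_mul]

end f3
end S13

namespace S13
section fin
variable {R : Type u} [CommRing R]

lemma functional_of_cyclic (ω : Type u) [AddCommGroup ω] [Module R ω]
    (hfaith : ∀ a : R, (∀ x : ω, a • x = 0) → a = 0) (e : ω) (s : R)
    (hs : ∀ x : ω, ∃ r : R, r • e = s • x) : ∃ f : ω →ₗ[R] R, f e = s * s := by
  have hk : ∀ t : R, t • e = 0 → s * t = 0 := by
    intro t ht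
    apply hfaith
    intro x
    obtain ⟨r, hr⟩ := hs x
    rw [mul_comm, mul_smul, ← hr, smul_comm, ht, smul_zero]
  have hk2 : ∀ t t' : R, t • e = t' • e → s * t = s * t' := by
    intro t t' h
    rw [← sub_eq_zero, ← mul_sub]
    apply hk
    rw [sub_smul, h, sub_self]
  choose r hr using hs
  refine ⟨{ toFun := fun x => s * r x
            map_add' := fun x y => ?_
            map_smul' := fun c x => ?_ }, ?_⟩
  · rw [← mul_add]
    apply hk2
    rw [add_smul, hr, hr, hr, smul_add]
  · rw [RingHom.id_apply, smul_eq_mul, mul_left_comm]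
    apply hk2
    rw [mul_smul, hr, hr, smul_comm]
  · exact hk2 _ _ (hr e)

open TensorProduct in
lemma exists_functional (C : Type u) [AddCommGroup C] [Module R C] [Module.Finite R C]
    (p : PrimeSpectrum R) (h : ∀ l : C →ₗ[R] p.asIdeal.ResidueField, l = 0) :
    p ∉ Module.support R C := by
  rw [Module.mem_support_iff_nontrivial_residueField_tensorProduct]
  intro hn
  obtain ⟨v, hv⟩ := exists_ne (0 : p.asIdeal.ResidueField ⊗[R] C)
  apply hv
  rw [← Module.forall_dual_apply_eq_zero_iff p.asIdeal.ResidueField]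
  intro g
  have h0 := h (g.restrictScalars R ∘ₗ TensorProduct.mk R p.asIdeal.ResidueField C 1)
  have h1 : ∀ c : C, g (1 ⊗ₜ[R] c) = 0 := fun c => LinearMap.congr_fun h0 c
  have key : ∀ z, g z = 0 := by
    intro z
    induction z using TensorProduct.induction_on with
    | zero => exact map_zero g
    | add x y hx hy => rw [map_add, hx, hy, add_zero]
    | tmul k c =>
      rw [← mul_one k, ← smul_eq_mul, ← TensorProduct.smul_tmul', map_smul, h1, smul_zero]
  exact key v

lemma trace_not_le [IsNoetherianRing R] (ω : Type u) [AddCommGroup ω] [Module R ω]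
    [Module.Finite R ω]
    (hfaith : ∀ a : R, (∀ x : ω, a • x = 0) → a = 0) (a : R)
    (hrel : ∀ x y : ω, ∃ N : ℕ, ∀ (K : Type u) [CommRing K] [Algebra R K] (l μ : ω →ₗ[R] K),
      a ^ N • (l y * μ x - l x * μ y) = 0)
    (p : Ideal R) [hp : p.IsPrime] (ht : traceIdeal R ω ≤ p) : a ∈ p := by
  by_contra hap
  have hrel' : ∀ (l μ : ω →ₗ[R] p.ResidueField) (x y : ω), l y * μ x = l x * μ y := by
    intro l μ x y
    obtain ⟨N, hN⟩ := hrel x y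
    have h1 := hN p.ResidueField l μ
    rw [Algebra.smul_def, mul_eq_zero, map_pow] at h1
    rcases h1 with h1 | h1
    · have h2 := eq_zero_of_pow_eq_zero h1
      rw [Ideal.algebraMap_residueField_eq_zero] at h2
      exact absurd h2 hap
    · exact sub_eq_zero.1 h1
  obtain ⟨e, he⟩ : ∃ e : ω, ∀ μ : ω →ₗ[R] p.ResidueField, μ e = 0 → μ = 0 := by
    by_cases h : ∀ l : ω →ₗ[R] p.ResidueField, l = 0
    · exact ⟨0, fun μ _ => h μ⟩
    · push Not at h
      obtain ⟨l, hl⟩ := h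
      obtain ⟨e, hle⟩ : ∃ e, l e ≠ 0 := by
        by_contra! h
        exact hl (LinearMap.ext h)
      refine ⟨e, fun μ hμ => LinearMap.ext fun x => ?_⟩
      have := hrel' l μ x e
      rw [hμ, mul_zero] at this
      exact (mul_eq_zero.1 this).resolve_left hle
  have hsup : (⟨p, hp⟩ : PrimeSpectrum R) ∉ Module.support R (ω ⧸ Submodule.span R {e}) := by
    apply exists_functional
    intro l
    have := he (l ∘ₗ Submodule.mkQ _) (by
      rw [LinearMap.comp_apply, Submodule.mkQ_apply,
        (Submodule.Quotient.mk_eq_zero _).2 (Submodule.mem_span_singleton_self e), map_zero])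
    apply Submodule.linearMap_qext
    rw [this, LinearMap.zero_comp]
  rw [Module.mem_support_iff_of_finite] at hsup
  obtain ⟨s, hs, hsp⟩ := SetLike.not_le_iff_exists.1 hsup
  obtain ⟨f, hf⟩ := functional_of_cyclic ω hfaith e s (fun x => by
    have := Module.mem_annihilator.1 hs (Submodule.Quotient.mk x)
    rw [← Submodule.Quotient.mk_smul, Submodule.Quotient.mk_eq_zero] at this
    exact Submodule.mem_span_singleton.1 this)
  have : f e ∈ p := ht (Submodule.mem_iSup_of_mem f ⟨e, rfl⟩)
  rw [hf] at this
  exact hsp (or_self_iff.1 (hp.mem_or_mem this))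

lemma trace_le (ω : Type u) [AddCommGroup ω] [Module R ω]
    (hA : ∀ (f : ω →ₗ[R] R) (x y : ω), f y • x = f x • y) (i : ℕ)
    (X : Type u) [AddCommGroup X] [Module R X] : traceIdeal R ω ≤ extAnn R (i + 1) ω X := by
  refine iSup_le fun f => ?_
  rintro _ ⟨x, rfl⟩
  rw [mem_extAnn]
  intro z
  have hc : LinearMap.toSpanSingleton R ω x ∘ₗ f = f x • LinearMap.id := by
    ext y
    exact hA f x y
  have h1 : f x • z = pull (i + 1) X f (pull (i + 1) X (LinearMap.toSpanSingleton R ω x) z) := by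
    rw [← pull_comp, hc, pull_smul_id]
  rw [h1, Subsingleton.elim (pull (i + 1) X (LinearMap.toSpanSingleton R ω x) z) 0, map_zero]

lemma ar_kill (ω : Type u) [AddCommGroup ω] [Module R ω] (a : R) (ha : a ∈ ARann R ω) (i : ℕ)
    (x : E R (i + 1) ω R) : a • x = 0 := by
  have h1 := mem_extAnn.1 ((Submodule.mem_iInf _).1 ha i)
  have h2 : x = push (i + 1) ω (LinearMap.snd R ω R) (push (i + 1) ω (LinearMap.inr R ω R) x) := by
    rw [← push_comp]
    have h3 : LinearMap.snd R ω R ∘ₗ LinearMap.inr R ω R = (1 : R) • LinearMap.id := by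
      rw [one_smul]; ext; rfl
    rw [h3, push_smul_id, one_smul]
  rw [h2, ← map_smul]
  have h4 : a • push (i + 1) ω (LinearMap.inr R ω R) x = 0 := h1 _
  rw [h4, map_zero]

lemma syz_le (ω : Type u) [AddCommGroup ω] [Module R ω]
    (S : Type u) [AddCommGroup S] [Module R S] (hS : IsSyzygy R ω S) :
    extAnn R 1 ω S ≤ ARann R ω := by
  obtain ⟨F, _, _, ι, π, hfree, _, hι, hπ, hr⟩ := hS
  intro a ha
  have ha' := mem_extAnn.1 ha
  have hex : Function.Exact ι π := LinearMap.exact_iff.2 hr.symm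
  have h1 : dV ι π hι hπ hex 0 ω (hom0 ω ω (a • LinearMap.id)) = 0 := by
    rw [map_smul, map_smul]; exact ha' _
  obtain ⟨y, hy⟩ := (push_dV_exact ι π hι hπ hex 0 _).1 h1
  obtain ⟨h, rfl⟩ := (hom0 _ _).surjective y
  rw [push_hom0, EmbeddingLike.apply_eq_iff_eq] at hy
  refine (Submodule.mem_iInf _).2 fun i => mem_extAnn.2 fun x => ?_
  have h2 : a • x = pull (i + 1) (ω × R) h (pull (i + 1) (ω × R) π x) := by
    rw [← pull_comp, hy, pull_smul_id]
  rw [h2, Subsingleton.elim (pull (i + 1) (ω × R) π x) 0, map_zero]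

end fin
end S13

/-- For a generically Gorenstein Cohen–Macaulay local ring with canonical module `ω`
whose trace ideal is radical, the stable annihilator of `ω` equals its
Auslander–Reiten annihilator. -/
theorem stmt13 (R : Type u) [CommRing R] [IsNoetherianRing R] [IsLocalRing R]
    (d : ℕ) (hdim : ringKrullDim R = (d : ℕ)) (hCM : moduleDepth R R = (d : ℕ∞))
    (ω : Type u) [AddCommGroup ω] [Module R ω] (hω : IsCanonicalModule R d ω)
    (hgen : ∀ (p : Ideal R) (hp : p.IsPrime), p ∈ minimalPrimes R →
      IsGorensteinLocal (Localization.AtPrime p))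
    (hrad : (traceIdeal R ω).IsRadical)
    (S : Type u) [AddCommGroup S] [Module R S] (hS : IsSyzygy R ω S) :
    extAnn R 1 ω S = ARann R ω := by
  obtain ⟨hfin, h1, h2⟩ := S13.canon_E hω
  obtain ⟨hend, hfaith⟩ := S13.F1 d hdim ω h1 h2
  have hA := S13.goalA d hdim ω h1 hend hfaith hgen
  refine le_antisymm (S13.syz_le ω S hS) fun a ha => ?_
  refine S13.trace_le ω hA 0 S ?_
  apply hrad
  rw [Ideal.radical_eq_sInf, Submodule.mem_sInf]
  rintro p ⟨hp, hpp⟩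
  refine S13.trace_not_le ω hfaith a (fun x y => ?_) p hp
  exact S13.rank_one_relation d ω (fun M _ _ _ i hi => S13.F0 d h1 i hi) hA a
    (S13.ar_kill ω a ha) x y
end

section
/- Let R be a d-dimensional complete Cohen–Macaulay local ring with canonical module ω which is an isolated singularity, and let M, N be maximal Cohen–Macaulay R-modules. Then ann_R Hom_R(M,N)/P(M,N) = ann_R Ext^{d+1}_R(Tr M, D N), where D = Hom_R(-, ω) and Tr M is the Auslander transpose of M. -/
open CategoryTheory Opposite IsLocalRing

universe u

variable (R : Type u) [CommRing R]

section bridge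
variable {R : Type u} [CommRing R]

/-- Abelian Ext between module types. -/
abbrev AExt (R : Type u) [CommRing R] (i : ℕ) (M N : Type u) [AddCommGroup M] [Module R M]
    [AddCommGroup N] [Module R N] : Type u :=
  Abelian.Ext (ModuleCat.of R M) (ModuleCat.of R N) i

lemma smul_extMk' {X Y : ModuleCat.{u} R} (P : ProjectiveResolution X) {n : ℕ} (r : R)
    (f : P.complex.X n ⟶ Y) (m : ℕ) (hm : n + 1 = m) (hf : P.complex.d m n ≫ f = 0) :
    r • P.extMk f m hm hf = P.extMk (r • f) m hm (by simp [hf]) := by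
  rw [Abelian.Ext.smul_eq_comp_mk₀, P.extMk_comp_mk₀]
  simp

lemma mem_ann_homology (S : ShortComplex (ModuleCat.{u} R)) (r : R) :
    r ∈ Module.annihilator R S.homology ↔
      ∀ x : S.X₂, S.g x = 0 → ∃ y : S.X₁, S.f y = r • x := by
  rw [S.moduleCatHomologyIso.toLinearEquiv.annihilator_eq, Module.mem_annihilator]
  change (∀ m : (LinearMap.ker S.g.hom) ⧸ LinearMap.range S.moduleCatToCycles, r • m = 0) ↔ _
  constructor
  · intro h x hx
    have := h (Submodule.Quotient.mk ⟨x, hx⟩)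
    rw [← Submodule.Quotient.mk_smul, Submodule.Quotient.mk_eq_zero] at this
    obtain ⟨y, hy⟩ := this
    exact ⟨y, congrArg Subtype.val hy⟩
  · intro h m
    obtain ⟨⟨x, hx⟩, rfl⟩ := Submodule.Quotient.mk_surjective _ m
    rw [← Submodule.Quotient.mk_smul, Submodule.Quotient.mk_eq_zero]
    obtain ⟨y, hy⟩ := h x hx
    exact ⟨y, Subtype.ext hy⟩

lemma mem_ann_ext_iff {X Y : ModuleCat.{u} R} (P : ProjectiveResolution X) (n : ℕ) (r : R) :
    r ∈ Module.annihilator R (((Ext R (ModuleCat.{u} R) n).obj (op X)).obj Y) ↔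
    ∀ f : P.complex.X n ⟶ Y, P.complex.d (n+1) n ≫ f = 0 →
      ∃ g : P.complex.X ((ComplexShape.up ℕ).prev n) ⟶ Y, P.complex.d n ((ComplexShape.up ℕ).prev n) ≫ g = r • f := by
  rw [(P.isoExt n Y).toLinearEquiv.annihilator_eq]
  have := mem_ann_homology ((P.complex.linearYonedaObj R Y).sc n) r
  refine this.trans ?_
  have e : (ComplexShape.up ℕ).next n = n + 1 := by simp
  constructor
  · intro h f hf
    refine h f ?_
    change P.complex.d ((ComplexShape.up ℕ).next n) n ≫ f = 0
    rw [e]; exact hf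
  · intro h f hf
    refine h f ?_
    change P.complex.d ((ComplexShape.up ℕ).next n) n ≫ f = 0 at hf
    rw [e] at hf; exact hf

lemma extAnn_eq (n : ℕ) (X Y : Type u) [AddCommGroup X] [Module R X]
    [AddCommGroup Y] [Module R Y] : extAnn R n X Y = Module.annihilator R (AExt R n X Y) := by
  let P := projectiveResolution (ModuleCat.of R X)
  ext r
  rw [extAnn, ExtMod, mem_ann_ext_iff P, Module.mem_annihilator]
  rcases n with _ | n
  · have e : (ComplexShape.up ℕ).prev 0 = 0 := by simp
    rw [e]
    obtain ⟨p, hp1, hp2, hp3⟩ : ∃ p : P.complex.X 0 ⟶ ModuleCat.of R X,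
        P.complex.d 1 0 ≫ p = 0 ∧ Epi p ∧ ∀ f : P.complex.X 0 ⟶ ModuleCat.of R Y,
          P.complex.d 1 0 ≫ f = 0 → ∃ φ : ModuleCat.of R X ⟶ ModuleCat.of R Y, p ≫ φ = f := by
      refine ⟨P.π.f 0, P.complex_d_comp_π_f_zero, inferInstanceAs (Epi (P.π.f 0)), fun f hf => ?_⟩
      obtain ⟨φ, hφ⟩ := P.exact₀.desc' f hf
      exact ⟨φ, hφ⟩
    constructor
    · intro h x
      obtain ⟨φ, rfl⟩ := (Abelian.Ext.mk₀_bijective _ _).2 x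
      obtain ⟨g, hg⟩ := h (p ≫ φ) (by
        rw [← Category.assoc]
        erw [hp1]; simp)
      rw [← Abelian.Ext.mk₀_smul]
      have h0 : P.complex.d 0 0 = 0 := P.complex.shape _ _ (by simp)
      rw [h0, Limits.zero_comp] at hg
      have : r • φ = 0 := by
        rw [← cancel_epi p, Limits.comp_zero, hg]
        simp
      rw [this]; simp
    · intro h f hf
      obtain ⟨φ, hφ⟩ := hp3 f hf
      have h1 := h (Abelian.Ext.mk₀ φ)
      rw [← Abelian.Ext.mk₀_smul] at h1
      have h2 : r • φ = 0 := (Abelian.Ext.mk₀_bijective _ _).1 (h1.trans (by simp))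
      refine ⟨0, ?_⟩
      rw [← hφ, ← Linear.comp_smul, h2]
      simp
  · have e : (ComplexShape.up ℕ).prev (n+1) = n := by simp
    rw [e]
    constructor
    · intro h x
      obtain ⟨f, hf, rfl⟩ := P.extMk_surjective x _ rfl
      rw [smul_extMk', P.extMk_eq_zero_iff _ _ _ _ n rfl]
      exact h f hf
    · intro h f hf
      have := h (P.extMk f _ rfl hf)
      rwa [smul_extMk', P.extMk_eq_zero_iff _ _ _ _ n rfl] at this

end bridge

section les
variable {R : Type u} [CommRing R]
variable {X₁ X₂ X₃ : Type u} [AddCommGroup X₁] [Module R X₁] [AddCommGroup X₂] [Module R X₂]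
  [AddCommGroup X₃] [Module R X₃] (Y : Type u) [AddCommGroup Y] [Module R Y]

/-- Contravariant functoriality of Ext. -/
noncomputable def extMap (f : X₁ →ₗ[R] X₂) (n : ℕ) : AExt R n X₂ Y →ₗ[R] AExt R n X₁ Y :=
  (Abelian.Ext.mk₀ (ModuleCat.ofHom f)).precompOfLinear R (ModuleCat.of R Y) (zero_add n)

variable {Y} in
lemma extMap_apply (f : X₁ →ₗ[R] X₂) (n : ℕ) (x : AExt R n X₂ Y) :
    extMap Y f n x = (Abelian.Ext.mk₀ (ModuleCat.ofHom f)).comp x (zero_add n) := rfl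

lemma extMap_comp (f : X₁ →ₗ[R] X₂) (g : X₂ →ₗ[R] X₃) (n : ℕ) :
    extMap Y (g ∘ₗ f) n = extMap Y f n ∘ₗ extMap Y g n := by
  ext x
  simp only [extMap_apply, LinearMap.comp_apply, ModuleCat.ofHom_comp]
  simp

lemma extMap_smul_id (r : R) (n : ℕ) (x : AExt R n X₁ Y) :
    extMap Y (r • (LinearMap.id : X₁ →ₗ[R] X₁)) n x = r • x := by
  rw [extMap_apply]
  have : ModuleCat.ofHom (r • (LinearMap.id : X₁ →ₗ[R] X₁)) = r • 𝟙 (ModuleCat.of R X₁) := rfl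
  rw [this, Abelian.Ext.mk₀_smul]
  simp

/-- Ext^0 is Hom. -/
noncomputable def ext0 : AExt R 0 X₁ Y ≃ₗ[R] (X₁ →ₗ[R] Y) :=
  Abelian.Ext.linearEquiv₀.trans ModuleCat.homLinearEquiv

lemma ext0_extMap (f : X₁ →ₗ[R] X₂) (x : AExt R 0 X₂ Y) :
    ext0 Y (extMap Y f 0 x) = ext0 Y x ∘ₗ f := by
  obtain ⟨φ, rfl⟩ := (Abelian.Ext.mk₀_bijective _ _).2 x
  rw [extMap_apply, Abelian.Ext.mk₀_comp_mk₀]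
  have key : ∀ {A B : ModuleCat.{u} R} (ψ : A ⟶ B), 
      Abelian.Ext.linearEquiv₀ (R := R) (Abelian.Ext.mk₀ ψ) = ψ := by
    intro A B ψ
    apply (Abelian.Ext.mk₀_bijective _ _).1
    rw [Abelian.Ext.mk₀_linearEquiv₀_apply]
  simp only [ext0, LinearEquiv.trans_apply, key]
  rfl

lemma ses (f : X₁ →ₗ[R] X₂) (g : X₂ →ₗ[R] X₃) (hf : Function.Injective f)
    (hfg : Function.Exact f g) (hg : Function.Surjective g) :
    ∃ w, (ShortComplex.mk (ModuleCat.ofHom f) (ModuleCat.ofHom g) w).ShortExact := by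
  refine ⟨by rw [← ModuleCat.ofHom_comp, hfg.linearMap_comp_eq_zero]; rfl, ?_⟩
  refine { exact := ?_, mono_f := (ModuleCat.mono_iff_injective _).2 hf, epi_g := (ModuleCat.epi_iff_surjective _).2 hg }
  rw [ShortComplex.moduleCat_exact_iff]
  intro x hx
  exact (hfg x).1 hx

/-- The long exact sequence. -/
lemma les (f : X₁ →ₗ[R] X₂) (g : X₂ →ₗ[R] X₃) (hf : Function.Injective f)
    (hfg : Function.Exact f g) (hg : Function.Surjective g) (n : ℕ) :
    Function.Exact (extMap Y g n) (extMap Y f n) ∧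
    ∃ δ : AExt R n X₁ Y →ₗ[R] AExt R (n+1) X₃ Y,
      Function.Exact (extMap Y f n) δ ∧ Function.Exact δ (extMap Y g (n+1)) := by
  obtain ⟨w, hS⟩ := ses f g hf hfg hg
  have hz : g ∘ₗ f = 0 := hfg.linearMap_comp_eq_zero
  refine ⟨?_, hS.extClass.precompOfLinear R (ModuleCat.of R Y) (add_comm 1 n), ?_, ?_⟩
  · intro x
    constructor
    · intro h
      exact Abelian.Ext.contravariant_sequence_exact₂ hS _ x h
    · rintro ⟨y, rfl⟩
      rw [← LinearMap.comp_apply, ← extMap_comp, hz]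
      rw [extMap_apply]
      simp
  · intro x
    constructor
    · intro h
      exact Abelian.Ext.contravariant_sequence_exact₁ hS _ x (add_comm 1 n) h
    · rintro ⟨y, rfl⟩
      exact hS.extClass_comp_assoc y (h := add_comm 1 n)
  · intro x
    constructor
    · intro h
      exact Abelian.Ext.contravariant_sequence_exact₃ hS _ x h (add_comm 1 n) 
    · rintro ⟨y, rfl⟩
      exact hS.comp_extClass_assoc y (by omega)

variable (f : X₁ →ₗ[R] X₂) (g : X₂ →ₗ[R] X₃) (hf : Function.Injective f)
    (hfg : Function.Exact f g) (hg : Function.Surjective g) (n : ℕ)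

lemma ext_mono0 (f : X₁ →ₗ[R] X₂) (hf : Function.Surjective f) :
    Function.Injective (extMap Y f 0) := by
  intro x y h
  apply (ext0 Y).injective
  have := congrArg (ext0 Y) h
  rw [ext0_extMap, ext0_extMap] at this
  exact (LinearMap.cancel_right hf).1 this

lemma ann_shift (hf : Function.Injective f)
    (hfg : Function.Exact f g) (hg : Function.Surjective g)
    (h1 : Subsingleton (AExt R n X₂ Y)) (h2 : Subsingleton (AExt R (n+1) X₂ Y)) :
    Module.annihilator R (AExt R n X₁ Y) = Module.annihilator R (AExt R (n+1) X₃ Y) := by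
  obtain ⟨-, δ, e1, e2⟩ := les Y f g hf hfg hg n
  refine (LinearEquiv.ofBijective δ ⟨?_, ?_⟩).annihilator_eq
  · rw [injective_iff_map_eq_zero]
    intro x hx
    obtain ⟨y, rfl⟩ := (e1 x).1 hx
    rw [Subsingleton.elim y 0, map_zero]
  · intro x
    exact (e2 x).1 (Subsingleton.elim _ _)

lemma ann_left (hf : Function.Injective f)
    (hfg : Function.Exact f g) (hg : Function.Surjective g)
    (h1 : Subsingleton (AExt R n X₃ Y)) (h2 : Subsingleton (AExt R (n+1) X₃ Y)) :
    Module.annihilator R (AExt R n X₂ Y) = Module.annihilator R (AExt R n X₁ Y) := by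
  obtain ⟨e0, δ, e1, e2⟩ := les Y f g hf hfg hg n
  refine (LinearEquiv.ofBijective (extMap Y f n) ⟨?_, ?_⟩).annihilator_eq
  · rw [injective_iff_map_eq_zero]
    intro x hx
    obtain ⟨y, rfl⟩ := (e0 x).1 hx
    rw [Subsingleton.elim y 0, map_zero]
  · intro x
    exact (e1 x).1 (Subsingleton.elim _ _)

lemma ann_right (hf : Function.Injective f)
    (hfg : Function.Exact f g) (hg : Function.Surjective g)
    (h1 : Subsingleton (AExt R n X₁ Y)) (h2 : Subsingleton (AExt R (n+1) X₁ Y)) :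
    Module.annihilator R (AExt R (n+1) X₃ Y) = Module.annihilator R (AExt R (n+1) X₂ Y) := by
  obtain ⟨e0, δ, e1, e2⟩ := les Y f g hf hfg hg n
  obtain ⟨e3, -⟩ := les Y f g hf hfg hg (n+1)
  refine (LinearEquiv.ofBijective (extMap Y g (n+1)) ⟨?_, ?_⟩).annihilator_eq
  · rw [injective_iff_map_eq_zero]
    intro x hx
    obtain ⟨y, rfl⟩ := (e2 x).1 hx
    rw [Subsingleton.elim y 0, map_zero]
  · intro x
    exact (e3 x).1 (Subsingleton.elim _ _)

lemma sub_mid (hf : Function.Injective f)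
    (hfg : Function.Exact f g) (hg : Function.Surjective g)
    (h1 : Subsingleton (AExt R n X₁ Y)) (h2 : Subsingleton (AExt R n X₃ Y)) :
    Subsingleton (AExt R n X₂ Y) := by
  obtain ⟨e0, -⟩ := les Y f g hf hfg hg n
  refine subsingleton_of_forall_eq 0 fun x => ?_
  obtain ⟨y, rfl⟩ := (e0 x).1 (Subsingleton.elim _ _)
  rw [Subsingleton.elim y 0, map_zero]

lemma sub_left (hf : Function.Injective f)
    (hfg : Function.Exact f g) (hg : Function.Surjective g)
    (h1 : Subsingleton (AExt R n X₂ Y)) (h2 : Subsingleton (AExt R (n+1) X₃ Y)) :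
    Subsingleton (AExt R n X₁ Y) := by
  obtain ⟨-, δ, e1, e2⟩ := les Y f g hf hfg hg n
  refine subsingleton_of_forall_eq 0 fun x => ?_
  obtain ⟨y, rfl⟩ := (e1 x).1 (Subsingleton.elim _ _)
  rw [Subsingleton.elim y 0, map_zero]

lemma sub_right (hf : Function.Injective f)
    (hfg : Function.Exact f g) (hg : Function.Surjective g)
    (h1 : Subsingleton (AExt R n X₁ Y)) (h2 : Subsingleton (AExt R (n+1) X₂ Y)) :
    Subsingleton (AExt R (n+1) X₃ Y) := by
  obtain ⟨-, δ, e1, e2⟩ := les Y f g hf hfg hg n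
  refine subsingleton_of_forall_eq 0 fun x => ?_
  obtain ⟨y, rfl⟩ := (e2 x).1 (Subsingleton.elim _ _)
  rw [Subsingleton.elim y 0, map_zero]

lemma mem_ann_ext_one (hf : Function.Injective f)
    (hfg : Function.Exact f g) (hg : Function.Surjective g)
    (h2 : Subsingleton (AExt R 1 X₂ Y)) (r : R) :
    r ∈ Module.annihilator R (AExt R 1 X₃ Y) ↔
      ∀ φ : X₁ →ₗ[R] Y, ∃ ψ : X₂ →ₗ[R] Y, ψ ∘ₗ f = r • φ := by
  obtain ⟨-, δ, e1, e2⟩ := les Y f g hf hfg hg 0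
  rw [Module.mem_annihilator]
  constructor
  · intro h φ
    have := h (δ ((ext0 Y).symm φ))
    rw [← map_smul] at this
    obtain ⟨y, hy⟩ := (e1 _).1 this
    refine ⟨ext0 Y y, ?_⟩
    rw [← ext0_extMap, hy]
    simp
  · intro h x
    obtain ⟨y, rfl⟩ := (e2 x).1 (Subsingleton.elim _ _)
    obtain ⟨ψ, hψ⟩ := h (ext0 Y y)
    rw [← map_smul]
    apply (e1 _).2
    refine ⟨(ext0 Y).symm ψ, (ext0 Y).injective ?_⟩
    rw [ext0_extMap]
    simpa using hψ

lemma ext_free (P : Type u) [AddCommGroup P] [Module R P] [Module.Projective R P] (n : ℕ) :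
    Subsingleton (AExt R (n+1) P Y) := by
  have : Projective (ModuleCat.of R P) := (IsProjective.iff_projective P).1 inferInstance
  exact Abelian.Ext.subsingleton_of_projective _ _ n

lemma sub_equiv (e : X₁ ≃ₗ[R] X₂) (n : ℕ) (h : Subsingleton (AExt R n X₂ Y)) :
    Subsingleton (AExt R n X₁ Y) := by
  refine subsingleton_of_forall_eq 0 fun x => ?_
  have h1 := extMap_comp Y e.toLinearMap e.symm.toLinearMap n
  have h2 : e.symm.toLinearMap ∘ₗ e.toLinearMap = (1:R) • LinearMap.id := by ext; simp
  have h3 := extMap_smul_id Y (1 : R) n x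
  rw [← h2, h1, LinearMap.comp_apply, Subsingleton.elim (extMap Y _ n x) 0, map_zero, one_smul] at h3
  exact h3.symm
end les

section localExt
open scoped Pointwise
variable {A : Type u} [CommRing A] [IsNoetherianRing A]

lemma sub_of_sub (Y : Type u) [AddCommGroup Y] [Module A Y]
    (X : Type u) [AddCommGroup X] [Module A X] [Subsingleton X] (n : ℕ) :
    Subsingleton (AExt A n X Y) := by
  rcases n with _ | n
  · exact (ext0 Y).toEquiv.subsingleton
  · exact ext_free Y X n

lemma sub_filtration (Y : Type u) [AddCommGroup Y] [Module A Y] (I : Ideal A) (n : ℕ)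
    (h : ∀ q : Ideal A, q.IsPrime → I ≤ q → Subsingleton (AExt A n (A ⧸ q) Y))
    (X : Type u) [AddCommGroup X] [Module A X] [hX : Module.Finite A X]
    (hI : I ≤ Module.annihilator A X) : Subsingleton (AExt A n X Y) := by
  revert hI
  induction hX using IsNoetherianRing.induction_on_isQuotientEquivQuotientPrime A with
  | subsingleton N => exact fun _ => sub_of_sub Y N n
  | quotient N p e =>
    intro hI
    rw [e.annihilator_eq, Ideal.annihilator_quotient] at hI
    exact sub_equiv Y e n (h _ p.2 hI)
  | exact N₁ N₂ N₃ f g hf hg hfg h₁ h₃ =>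
    intro hI
    exact sub_mid Y f g n hf hfg hg (h₁ (hI.trans (f.annihilator_le_of_injective hf)))
      (h₃ (hI.trans (g.annihilator_le_of_surjective hg)))

variable [IsLocalRing A]

/-- Nakayama step. -/
lemma sub_nak (Y : Type u) [AddCommGroup Y] [Module A Y] [Module.Finite A Y]
    (X : Type u) [AddCommGroup X] [Module A X] [Module.Finite A X] (n : ℕ)
    (x : A) (hx : x ∈ maximalIdeal A) (hreg : IsSMulRegular X x)
    (h : Subsingleton (AExt A (n+1) (QuotSMulTop x X) Y)) : Subsingleton (AExt A n X Y) := by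
  obtain ⟨-, δ, e1, -⟩ := les Y (x • (LinearMap.id : X →ₗ[A] X)) (x • (⊤ : Submodule A X)).mkQ
    hreg (by exact LinearMap.exact_lsmul_mkQ_smul_top X x) (Submodule.mkQ_surjective _) n
  have hs : ∀ y : AExt A n X Y, ∃ z, x • z = y := fun y => by
    obtain ⟨z, hz⟩ := (e1 y).1 (Subsingleton.elim _ _)
    exact ⟨z, by rw [← hz, extMap_smul_id]⟩
  have hfin : Module.Finite A (AExt A n X Y) := inferInstance
  have : (⊤ : Submodule A (AExt A n X Y)) = ⊥ := by
    apply Submodule.eq_bot_of_le_smul_of_le_jacobson_bot (maximalIdeal A) _ hfin.fg_top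
    · intro y _
      obtain ⟨z, rfl⟩ := hs y
      exact Submodule.smul_mem_smul hx trivial
    · exact (IsLocalRing.jacobson_eq_maximalIdeal ⊥ bot_ne_top).ge
  exact (Submodule.subsingleton_iff A).1 (subsingleton_of_bot_eq_top this.symm)

/-- Finite injective dimension is detected on the residue field. -/
lemma id_lemma (Y : Type u) [AddCommGroup Y] [Module A Y] [Module.Finite A Y] (d : ℕ)
    (h : ∀ i, d < i → Subsingleton (AExt A i (ResidueField A) Y))
    (X : Type u) [AddCommGroup X] [Module A X] [hX : Module.Finite A X] (i : ℕ) (hi : d < i) :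
    Subsingleton (AExt A i X Y) := by
  have key : ∀ p : Ideal A, p.IsPrime → ∀ i, d < i → Subsingleton (AExt A i (A ⧸ p) Y) := by
    intro p
    induction p using WellFoundedGT.induction with
    | ind p ih =>
      intro hp i hi
      by_cases hm : p = maximalIdeal A
      · subst hm; exact h i hi
      obtain ⟨x, hx, hxp⟩ := SetLike.exists_of_lt (lt_of_le_of_ne (le_maximalIdeal hp.ne_top) hm)
      have hreg : IsSMulRegular (A ⧸ p) x := by
        rw [isSMulRegular_iff_right_eq_zero_of_smul]
        intro y hy
        obtain ⟨y, rfl⟩ := Ideal.Quotient.mk_surjective y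
        have : x * y ∈ p := Ideal.Quotient.eq_zero_iff_mem.1 hy
        exact Ideal.Quotient.eq_zero_iff_mem.2 ((hp.mem_or_mem this).resolve_left hxp)
      refine sub_nak Y (A ⧸ p) i x hx hreg ?_
      refine sub_filtration Y (p ⊔ Ideal.span {x}) (i+1) ?_ _ ?_
      · intro q hq hle
        refine ih q (lt_of_le_of_ne (le_sup_left.trans hle) ?_) hq _ (by omega)
        rintro rfl
        exact hxp (hle (Ideal.mem_sup_right (Ideal.mem_span_singleton_self x)))
      · refine sup_le ?_ ?_
        · refine le_trans ?_ ((x • (⊤ : Submodule A (A ⧸ p))).mkQ.annihilator_le_of_surjective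
            (Submodule.mkQ_surjective _))
          rw [Ideal.annihilator_quotient]
        · rw [Ideal.span_singleton_le_iff_mem, Module.mem_annihilator]
          intro y
          obtain ⟨y, rfl⟩ := Submodule.mkQ_surjective _ y
          rw [← map_smul]
          exact (Submodule.Quotient.mk_eq_zero _).2 (Submodule.smul_mem_pointwise_smul _ _ _ trivial)
  exact sub_filtration Y ⊥ i (fun q hq _ => key q hq i hi) X bot_le

lemma mcm_vanish (Y : Type u) [AddCommGroup Y] [Module A Y] [Module.Finite A Y] (d : ℕ)
    (h : ∀ i, d < i → Subsingleton (AExt A i (ResidueField A) Y)) (rs : List A) :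
    ∀ (X : Type u) [AddCommGroup X] [Module A X] [Module.Finite A X],
    (∀ r ∈ rs, r ∈ maximalIdeal A) → RingTheory.Sequence.IsWeaklyRegular X rs →
    ∀ j, d < j + rs.length → Subsingleton (AExt A j X Y) := by
  induction rs with
  | nil => intro X _ _ _ _ _ j hj; exact id_lemma Y d h X j (by simpa using hj)
  | cons r rs ih =>
    intro X _ _ _ hm hr j hj
    rw [RingTheory.Sequence.isWeaklyRegular_cons_iff] at hr
    refine sub_nak Y X j r (hm r (by simp)) hr.1 ?_
    exact ih (QuotSMulTop r X) (fun s hs => hm s (by simp [hs])) hr.2 (j+1)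
      (by simp only [List.length_cons] at hj; omega)

lemma prime_eq_max (k : ℕ) (q : Ideal A) (hq : q.IsPrime) (h : maximalIdeal A ^ k ≤ q) :
    q = maximalIdeal A :=
  le_antisymm (le_maximalIdeal hq.ne_top) (hq.le_of_pow_le h)

/-- Vanishing for finite length modules. -/
lemma fl_vanish (Y : Type u) [AddCommGroup Y] [Module A Y] (i : ℕ)
    (h : Subsingleton (AExt A i (ResidueField A) Y))
    (X : Type u) [AddCommGroup X] [Module A X] [hX : Module.Finite A X] (k : ℕ)
    (hk : maximalIdeal A ^ k ≤ Module.annihilator A X) : Subsingleton (AExt A i X Y) :=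
  sub_filtration Y _ i (fun q hq hle => by
    obtain rfl := prime_eq_max k q hq hle; exact h) X hk

lemma fl_nonvanish (Y : Type u) [AddCommGroup Y] [Module A Y] (d : ℕ)
    (h : Subsingleton (AExt A (d+1) (ResidueField A) Y))
    (hne : ¬ Subsingleton (AExt A d (ResidueField A) Y))
    (X : Type u) [AddCommGroup X] [Module A X] [hX : Module.Finite A X] (k : ℕ)
    (hk : maximalIdeal A ^ k ≤ Module.annihilator A X)
    (h0 : Subsingleton (AExt A d X Y)) : Subsingleton X := by
  by_contra hX
  rw [not_subsingleton_iff_nontrivial] at hX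
  obtain ⟨p, hp⟩ := associatedPrimes.nonempty A X
  obtain ⟨hpp, f, hf⟩ := (isAssociatedPrime_iff_exists_injective_linearMap p X).1 hp
  have : p = maximalIdeal A := by
    apply prime_eq_max k p hpp
    refine hk.trans ?_
    have := f.annihilator_le_of_injective hf
    rwa [Ideal.annihilator_quotient] at this
  subst this
  apply hne
  refine sub_left Y f (LinearMap.range f).mkQ d hf (LinearMap.exact_map_mkQ_range f)
    (Submodule.mkQ_surjective _) h0 ?_
  exact fl_vanish Y (d+1) h _ k (hk.trans
    ((LinearMap.range f).mkQ.annihilator_le_of_surjective (Submodule.mkQ_surjective _)))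

lemma fl_ann (Y : Type u) [AddCommGroup Y] [Module A Y] (d : ℕ)
    (h : ∀ i, i ≠ d → Subsingleton (AExt A i (ResidueField A) Y))
    (hne : ¬ Subsingleton (AExt A d (ResidueField A) Y))
    (X : Type u) [AddCommGroup X] [Module A X] [hX : Module.Finite A X] (k : ℕ)
    (hk : maximalIdeal A ^ k ≤ Module.annihilator A X) :
    Module.annihilator A (AExt A d X Y) = Module.annihilator A X := by
  apply le_antisymm
  · intro r hr
    rw [Module.mem_annihilator] at hr
    let φ : X →ₗ[A] X := r • LinearMap.id
    let p : X →ₗ[A] LinearMap.range φ := φ.rangeRestrict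
    let ι : LinearMap.range φ →ₗ[A] X := (LinearMap.range φ).subtype
    have hp : Function.Surjective p := φ.surjective_rangeRestrict
    have hι : Function.Injective ι := Subtype.val_injective
    have hfac : ι ∘ₗ p = r • LinearMap.id := rfl
    have hkr : maximalIdeal A ^ k ≤ Module.annihilator A (LinearMap.range φ) :=
      hk.trans (ι.annihilator_le_of_injective hι)
    have hsub : Subsingleton (LinearMap.range φ) := by
      refine fl_nonvanish Y d (h _ (by omega)) hne _ k hkr ?_
      have hinj : Function.Injective (extMap Y p d) := by
        rcases d with _ | d
        · exact ext_mono0 Y p hp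
        · obtain ⟨-, δ, -, e2⟩ := les Y (LinearMap.ker p).subtype p Subtype.val_injective
            (LinearMap.exact_subtype_ker_map p) hp d
          have : Subsingleton (AExt A d (LinearMap.ker p) Y) :=
            fl_vanish Y d (h _ (by omega)) _ k (hk.trans
              ((LinearMap.ker p).subtype.annihilator_le_of_injective Subtype.val_injective))
          rw [injective_iff_map_eq_zero]
          intro x hx
          obtain ⟨y, rfl⟩ := (e2 x).1 hx
          rw [Subsingleton.elim y 0, map_zero]
      have hsurj : Function.Surjective (extMap Y ι d) := by
        obtain ⟨-, δ, e1, -⟩ := les Y ι (LinearMap.range ι).mkQ hι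
          (LinearMap.exact_map_mkQ_range ι) (Submodule.mkQ_surjective _) d
        have : Subsingleton (AExt A (d+1) (X ⧸ LinearMap.range ι) Y) :=
          fl_vanish Y (d+1) (h _ (by omega)) _ k (hk.trans
            ((LinearMap.range ι).mkQ.annihilator_le_of_surjective (Submodule.mkQ_surjective _)))
        intro x
        exact (e1 x).1 (Subsingleton.elim _ _)
      refine subsingleton_of_forall_eq 0 fun x => ?_
      obtain ⟨y, rfl⟩ := hsurj x
      apply hinj
      rw [← LinearMap.comp_apply, ← extMap_comp, hfac, extMap_smul_id, hr, map_zero]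
    rw [Module.mem_annihilator]
    intro x
    have : p x = 0 := Subsingleton.elim _ _
    exact congrArg Subtype.val this
  · intro r hr
    rw [Module.mem_annihilator] at hr ⊢
    intro x
    rw [← extMap_smul_id]
    have : r • (LinearMap.id : X →ₗ[A] X) = 0 := by ext x; simpa using hr x
    rw [this, extMap_apply]
    simp

/-- The canonical module is faithful. -/
lemma can_faithful (Y : Type u) [AddCommGroup Y] [Module A Y] (d : ℕ)
    (h : ∀ i, i ≠ d → Subsingleton (AExt A i (ResidueField A) Y))
    (hne : ¬ Subsingleton (AExt A d (ResidueField A) Y)) (r : A)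
    (hr : ∀ y : Y, r • y = 0) : r = 0 := by
  have : ∀ k, r ∈ maximalIdeal A ^ k := by
    intro k
    have := fl_ann Y d h hne (A ⧸ maximalIdeal A ^ k) k (by rw [Ideal.annihilator_quotient])
    rw [Ideal.annihilator_quotient] at this
    rw [← this, Module.mem_annihilator]
    intro x
    rw [Abelian.Ext.smul_eq_comp_mk₀]
    have : r • 𝟙 (ModuleCat.of A Y) = 0 := by
      ext y; exact hr y
    rw [this]
    simp
  have h2 := Ideal.iInf_pow_eq_bot_of_isLocalRing (maximalIdeal A) (Ideal.IsPrime.ne_top')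
  have h3 : r ∈ (⨅ i : ℕ, maximalIdeal A ^ i) := by simpa [Ideal.mem_iInf] using this
  rwa [h2] at h3

/-- Direct sums. -/
lemma sub_pi (Y : Type u) [AddCommGroup Y] [Module A Y] (X : Type u) [AddCommGroup X]
    [Module A X] (j : ℕ) (h : Subsingleton (AExt A j X Y)) (n : ℕ) :
    Subsingleton (AExt A j (Fin n → X) Y) := by
  induction n with
  | zero => exact sub_of_sub Y _ j
  | succ n ih =>
    refine sub_mid Y (X₁ := X) (X₂ := Fin (n+1) → X) (X₃ := Fin n → X)
      (LinearMap.single A (fun _ => X) 0) (LinearMap.funLeft A X Fin.succ) j ?_ ?_ ?_ h ih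
    · exact Pi.single_injective (M := fun _ : Fin (n+1) => X) 0
    · intro x
      constructor
      · intro hx
        refine ⟨x 0, ?_⟩
        ext i
        refine Fin.cases ?_ (fun i => ?_) i
        · simp
        · have := congrFun hx i
          simp [LinearMap.funLeft_apply] at this
          simp [this]
      · rintro ⟨y, rfl⟩
        ext i
        simp [LinearMap.funLeft_apply]
    · exact LinearMap.funLeft_surjective_of_injective _ _ _ (Fin.succ_injective n)

lemma sub_tensor (Y : Type u) [AddCommGroup Y] [Module A Y] (X : Type u) [AddCommGroup X]
    [Module A X] (j : ℕ) (h : Subsingleton (AExt A j X Y)) (P : Type u) [AddCommGroup P]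
    [Module A P] [Module.Free A P] [Module.Finite A P] :
    Subsingleton (AExt A j (TensorProduct A P X) Y) := by
  let b := Module.finBasis A P
  let e : TensorProduct A P X ≃ₗ[A] (Fin (Module.finrank A P) → X) :=
    (TensorProduct.comm A P X).trans ((TensorProduct.congr (LinearEquiv.refl A X) b.equivFun).trans
      (TensorProduct.piScalarRight A A X _))
  exact sub_equiv Y e j (sub_pi Y X j h _)

end localExt

section regular

open scoped Pointwise in
lemma regular_aux (h : ℕ) : ∀ (A : Type u) [CommRing A] [IsNoetherianRing A] [IsLocalRing A]
    (s : Finset A), s.card ≤ h → ((h : ℕ) : WithBot ℕ∞) ≤ ringKrullDim A →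
    Ideal.span (s : Set A) = maximalIdeal A →
    IsDomain A ∧ ∃ rs : List A, RingTheory.Sequence.IsWeaklyRegular A rs ∧
      Ideal.ofList rs = maximalIdeal A := by
  classical
  induction h with
  | zero =>
    intro A _ _ _ s hs _ hspan
    obtain rfl : s = ∅ := by simpa using hs
    have hm : maximalIdeal A = ⊥ := by rw [← hspan]; simp
    refine ⟨(IsLocalRing.isField_iff_maximalIdeal_eq.2 hm).isDomain, [], ?_, ?_⟩
    · simp
    · rw [hm]; simp
  | succ h ih =>
    intro A _ _ _ s hs hdim hspan
    have hmin : ∀ q ∈ minimalPrimes A, ¬ maximalIdeal A ≤ q := by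
      intro q hq hle
      have hqp : q.IsPrime := hq.1.1
      have hqm : q = maximalIdeal A := le_antisymm (le_maximalIdeal hqp.ne_top) hle
      subst hqm
      have h1 := IsLocalRing.maximalIdeal_height_eq_ringKrullDim (R := A)
      have h0 : (maximalIdeal A).height = 0 := by
        exact Ideal.height_eq_zero_iff.2 hq
      rw [h0] at h1
      rw [← h1] at hdim
      have : ((h + 1 : ℕ) : ℕ∞) ≤ 0 := by exact_mod_cast hdim
      simp at this
    have hsq : ¬ maximalIdeal A ≤ maximalIdeal A ^ 2 := by
      intro hle
      have : maximalIdeal A = ⊥ := by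
        apply Submodule.eq_bot_of_le_smul_of_le_jacobson_bot (maximalIdeal A) _
          (IsNoetherian.noetherian _)
        · rwa [smul_eq_mul, ← pow_two]
        · exact (IsLocalRing.jacobson_eq_maximalIdeal ⊥ bot_ne_top).ge
      obtain ⟨q, hq, -⟩ := Ideal.exists_minimalPrimes_le (I := ⊥) (J := maximalIdeal A) bot_le
      exact hmin q hq (this.le.trans bot_le)
    obtain ⟨x, hxm, hxs, hxq⟩ : ∃ x ∈ maximalIdeal A, x ∉ maximalIdeal A ^ 2 ∧
        ∀ q ∈ minimalPrimes A, x ∉ q := by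
      by_contra! hcon
      have := (Ideal.subset_union_prime_finite (s := insert (maximalIdeal A ^ 2) (minimalPrimes A))
        ((minimalPrimes.finite_of_isNoetherianRing A).insert _) (f := id) (maximalIdeal A ^ 2)
        (maximalIdeal A ^ 2) (fun i hi hne _ => by
          rcases hi with rfl | hi
          · exact absurd rfl hne
          · exact hi.1.1) (I := maximalIdeal A)).1 (by
          intro y hy
          simp only [Set.mem_iUnion]
          by_cases hy2 : y ∈ maximalIdeal A ^ 2
          · exact ⟨_, Set.mem_insert _ _, hy2⟩
          · obtain ⟨q, hq, hyq⟩ := hcon y hy hy2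
            exact ⟨q, Set.mem_insert_of_mem _ hq, hyq⟩)
      obtain ⟨i, hi, hle⟩ := this
      rcases hi with rfl | hi
      · exact hsq hle
      · exact hmin i hi hle
    -- exchange
    obtain ⟨a, has, haspan⟩ : ∃ a ∈ s, maximalIdeal A ≤
        Ideal.span ((s.erase a : Finset A) : Set A) ⊔ Ideal.span {x} := by
      have hx' := hxm
      rw [← hspan] at hx'
      obtain ⟨f, -, hf⟩ := Submodule.mem_span_finset.1 hx'
      obtain ⟨a, ha, hfa⟩ : ∃ a ∈ s, f a ∉ maximalIdeal A := by
        by_contra! hcon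
        apply hxs
        rw [← hf, pow_two]
        refine Ideal.sum_mem _ fun a ha => Ideal.mul_mem_mul (hcon a ha) ?_
        rw [← hspan]; exact Ideal.subset_span ha
      refine ⟨a, ha, ?_⟩
      have hu : IsUnit (f a) := by simpa using hfa
      conv_lhs => rw [← hspan]
      rw [Ideal.span_le]
      intro b hb
      by_cases hba : b = a
      · subst hba
        have : f b * b ∈ Ideal.span ((s.erase b : Finset A) : Set A) ⊔ Ideal.span {x} := by
          have e : f b * b = x - ∑ c ∈ s.erase b, f c • c := by
            rw [← hf, ← Finset.add_sum_erase s _ ha]; simp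
          rw [e]
          refine Ideal.sub_mem _ (Ideal.mem_sup_right (Ideal.mem_span_singleton_self x))
            (Ideal.mem_sup_left (Ideal.sum_mem _ fun c hc => Ideal.mul_mem_left _ _
              (Ideal.subset_span hc)))
        exact (Ideal.unit_mul_mem_iff_mem _ hu).1 this
      · exact Ideal.mem_sup_left (Ideal.subset_span (by simpa [hba] using hb))
    let J : Ideal A := Ideal.span {x}
    have hJm : J ≤ maximalIdeal A := by
      rw [Ideal.span_singleton_le_iff_mem]; exact hxm
    have hnt : Nontrivial (A ⧸ J) :=
      Ideal.Quotient.nontrivial_iff.2 (ne_top_of_le_ne_top Ideal.IsPrime.ne_top' hJm)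
    have hloc : IsLocalRing (A ⧸ J) :=
      IsLocalRing.of_surjective' (Ideal.Quotient.mk J) Ideal.Quotient.mk_surjective
    have hmap : maximalIdeal (A ⧸ J) = (maximalIdeal A).map (Ideal.Quotient.mk J) := by
      symm
      apply IsLocalRing.eq_maximalIdeal
      exact Ideal.IsMaximal.map_of_surjective_of_ker_le Ideal.Quotient.mk_surjective
        (by rwa [Ideal.mk_ker])
    have hle : maximalIdeal A ≤ Ideal.span ((s.erase a : Finset A) : Set A) ⊔ J := haspan
    have hspan' : Ideal.span (((s.erase a).image (Ideal.Quotient.mk J) : Finset (A ⧸ J)) : Set (A ⧸ J))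
        = maximalIdeal (A ⧸ J) := by
      rw [Finset.coe_image, ← Ideal.map_span, hmap]
      apply le_antisymm
      · apply Ideal.map_mono
        rw [← hspan]
        exact Ideal.span_mono (by simp)
      · refine (Ideal.map_mono hle).trans ?_
        rw [Ideal.map_sup, Ideal.map_quotient_self, sup_bot_eq]
    have hcard : ((s.erase a).image (Ideal.Quotient.mk J)).card ≤ h := by
      refine Finset.card_image_le.trans ?_
      rw [Finset.card_erase_of_mem has]; omega
    have hdim' : ((h : ℕ) : WithBot ℕ∞) ≤ ringKrullDim (A ⧸ J) := by
      have h1 := IsLocalRing.maximalIdeal_height_eq_ringKrullDim (R := A)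
      have h2 := Ideal.height_le_ringKrullDim_quotient_add_one hxm
      rw [h1] at h2
      have h3 := hdim.trans h2
      have : ((h : ℕ) : WithBot ℕ∞) + 1 ≤ ringKrullDim (A ⧸ J) + 1 := by exact_mod_cast h3
      generalize ringKrullDim (A ⧸ J) = v at this
      cases v with
      | bot => simp at this
      | coe w =>
        have h4 : (h : ℕ∞) + 1 ≤ w + 1 := by exact_mod_cast this
        have h5 : (h : ℕ∞) ≤ w := (ENat.add_le_add_iff_right (by simp)).1 h4
        exact_mod_cast h5
    obtain ⟨hdom, rs, hrs, hrsm⟩ := ih (A ⧸ J) _ hcard hdim' hspan'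
    have hJp : J.IsPrime := (Ideal.Quotient.isDomain_iff_prime J).1 hdom
    obtain ⟨q, hq, hqJ⟩ := Ideal.exists_minimalPrimes_le (I := ⊥) (J := J) bot_le
    have hxq' := hxq q hq
    have hqp : q.IsPrime := hq.1.1
    have hqbot : q = ⊥ := by
      apply Submodule.eq_bot_of_le_smul_of_le_jacobson_bot (maximalIdeal A) _
        (IsNoetherian.noetherian _)
      · intro y hy
        obtain ⟨z, rfl⟩ := Ideal.mem_span_singleton'.1 (hqJ hy)
        rw [mul_comm]
        exact Ideal.mul_mem_mul hxm ((hqp.mem_or_mem hy).resolve_right hxq')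
      · exact (IsLocalRing.jacobson_eq_maximalIdeal ⊥ bot_ne_top).ge
    have hdomA : IsDomain A := by
      subst hqbot
      exact IsDomain.of_bot_isPrime A
    refine ⟨hdomA, ?_⟩
    obtain ⟨rs', rfl⟩ : ∃ rs' : List A, rs'.map (Ideal.Quotient.mk J) = rs :=
      List.map_surjective_iff.2 Ideal.Quotient.mk_surjective rs
    refine ⟨x :: rs', ?_, ?_⟩
    · rw [RingTheory.Sequence.isWeaklyRegular_cons_iff]
      refine ⟨?_, ?_⟩
      · rw [isSMulRegular_iff_right_eq_zero_of_smul]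
        intro y hy
        refine (mul_eq_zero.1 hy).resolve_left ?_
        rintro rfl
        exact hxq' q.zero_mem
      · have e : QuotSMulTop x A ≃ₗ[A] A ⧸ J := Submodule.quotEquivOfEq _ _ (by
          ext y
          rw [Submodule.mem_smul_pointwise_iff_exists, Ideal.mem_span_singleton']
          constructor
          · rintro ⟨b, -, rfl⟩; exact ⟨b, mul_comm _ _⟩
          · rintro ⟨b, rfl⟩; exact ⟨b, trivial, mul_comm _ _⟩)
        rw [e.isWeaklyRegular_congr]
        exact (RingTheory.Sequence.isWeaklyRegular_map_algebraMap_iff (A ⧸ J) (A ⧸ J) rs').1 hrs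
    · rw [Ideal.ofList_cons]
      have h1 : (Ideal.ofList rs').map (Ideal.Quotient.mk J) =
          (maximalIdeal A).map (Ideal.Quotient.mk J) := by
        rw [Ideal.map_ofList, hrsm, hmap]
      have h2 := congrArg (Ideal.comap (Ideal.Quotient.mk J)) h1
      rw [Ideal.comap_map_of_surjective _ Ideal.Quotient.mk_surjective,
        Ideal.comap_map_of_surjective _ Ideal.Quotient.mk_surjective, ← RingHom.ker_eq_comap_bot,
        Ideal.mk_ker, sup_eq_left.2 hJm] at h2
      rw [sup_comm]; exact h2

/-- Over a regular local ring, f.g. modules have finite projective dimension. -/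
lemma regular_pd (A : Type u) [CommRing A] [IsLocalRing A] (hA : IsRegularLocal A) :
    ∃ n : ℕ, ∀ (X : Type u) [AddCommGroup X] [Module A X] [Module.Finite A X],
      HasProjectiveDimensionLT (ModuleCat.of A X) n := by
  obtain ⟨hN, h, s, hdim, hs, hspan⟩ := hA
  obtain ⟨-, rs, hrs, hrsm⟩ := regular_aux h A s hs.le hdim.ge hspan
  have hmem : ∀ r ∈ rs, r ∈ maximalIdeal A := by
    intro r hr
    rw [← hrsm]
    exact Ideal.subset_span hr
  have hreg : RingTheory.Sequence.IsRegular A rs :=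
    (IsLocalRing.isRegular_iff_isWeaklyRegular_of_subset_maximalIdeal hmem).2 hrs
  have hpd := ModuleCat.projectiveDimension_quotient_eq_length.{u} rs hreg
  have hk : HasProjectiveDimensionLT (ModuleCat.of A (ResidueField A)) (rs.length + 1) := by
    have h1 : HasProjectiveDimensionLT
        (ModuleCat.of A (Shrink.{u} (A ⧸ Ideal.ofList rs))) (rs.length + 1) :=
      (projectiveDimension_le_iff _ _).1 hpd.le
    have e : Shrink.{u} (A ⧸ Ideal.ofList rs) ≃ₗ[A] ResidueField A :=
      (Shrink.linearEquiv A _).trans (Submodule.quotEquivOfEq _ _ hrsm)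
    exact hasProjectiveDimensionLT_of_iso e.toModuleIso _
  refine ⟨rs.length + 1, fun X _ _ _ => ?_⟩
  refine ModuleCat.hasProjectiveDimensionLT_of_forall_finite _ _ fun L hL => ?_
  have := id_lemma (A := A) L rs.length (fun i hi =>
    HasProjectiveDimensionLT.subsingleton _ (rs.length+1) i hi _) X (rs.length + 1) (by omega)
  exact this

end regular

section freeness

lemma exists_resfunctional (A : Type u) [CommRing A] [IsLocalRing A] (W : Type u) [AddCommGroup W]
    [Module A W] [Module.Finite A W] [Nontrivial W] :
    ∃ (l : W →ₗ[A] ResidueField A) (w : W), l w ≠ 0 := by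
  by_contra! hcon
  have hnt : Nontrivial (TensorProduct A (ResidueField A) W) := by
    rw [← not_subsingleton_iff_nontrivial, IsLocalRing.subsingleton_tensorProduct]
    exact not_subsingleton W
  obtain ⟨v, hv⟩ := exists_ne (0 : TensorProduct A (ResidueField A) W)
  apply hv
  rw [← Module.forall_dual_apply_eq_zero_iff (ResidueField A)]
  intro f
  induction v with
  | zero => simp
  | add x y hx hy =>
    rw [map_add]
    have key : ∀ x, f x = 0 := by
      intro x
      induction x with
      | zero => simp
      | add x y hx hy => rw [map_add, hx, hy, add_zero]
      | tmul c w =>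
        have h1 := hcon ((f.restrictScalars A) ∘ₗ TensorProduct.mk A _ _ 1) w
        have h2 : (c ⊗ₜ[A] w : TensorProduct A (ResidueField A) W) = c • (1 ⊗ₜ[A] w) := by
          rw [TensorProduct.smul_tmul', smul_eq_mul, mul_one]
        rw [h2, map_smul]
        have h3 : f (1 ⊗ₜ[A] w) = 0 := h1
        rw [h3, smul_zero]
    rw [key, key, add_zero]
  | tmul c w =>
    have h1 := hcon ((f.restrictScalars A) ∘ₗ TensorProduct.mk A _ _ 1) w
    have h2 : (c ⊗ₜ[A] w : TensorProduct A (ResidueField A) W) = c • (1 ⊗ₜ[A] w) := by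
      rw [TensorProduct.smul_tmul', smul_eq_mul, mul_one]
    rw [h2, map_smul]
    have h3 : f (1 ⊗ₜ[A] w) = 0 := h1
    rw [h3, smul_zero]

lemma free_of_extend (A : Type u) [CommRing A] [IsLocalRing A] (Z F X W : Type u)
    [AddCommGroup Z] [Module A Z] [AddCommGroup F] [Module A F] [AddCommGroup X] [Module A X]
    [AddCommGroup W] [Module A W] [Module.Finite A W] [Nontrivial W]
    [Module.Free A Z] [Module.Finite A Z] [Module.Free A F] [Module.Finite A F]
    (l : Z →ₗ[A] F) (g : F →ₗ[A] X) (hg : Function.Surjective g) (hlg : Function.Exact l g)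
    (hext : ∀ φ : Z →ₗ[A] W, ∃ ψ : F →ₗ[A] W, ψ ∘ₗ l = φ) : Module.Free A X := by
  obtain ⟨t, w, htw⟩ := exists_resfunctional A W
  refine Module.free_of_lTensor_residueField_injective l g hg hlg ?_
  rw [injective_iff_map_eq_zero]
  intro v hv
  let b := Module.Free.chooseBasis A Z
  let B := Algebra.TensorProduct.basis (ResidueField A) b
  apply B.repr.injective
  ext i
  rw [map_zero, Finsupp.zero_apply]
  let φ : Z →ₗ[A] W := (b.coord i).smulRight w
  obtain ⟨ψ, hψ⟩ := hext φ
  have key : ∀ v, (LinearMap.mul' A (ResidueField A)) ((t ∘ₗ φ).lTensor (ResidueField A) v) =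
      B.repr v i * t w := by
    intro v
    induction v with
    | zero => simp
    | add x y hx hy => simp only [map_add, Finsupp.add_apply, hx, hy, add_mul]
    | tmul c z =>
      simp [B, φ, Algebra.TensorProduct.basis_repr_tmul, Algebra.smul_def, mul_assoc]
  have h1 := key v
  rw [← hψ, ← LinearMap.comp_assoc, LinearMap.lTensor_comp_apply, hv, map_zero, map_zero] at h1
  exact (mul_eq_zero.1 h1.symm).resolve_right htw


variable {R : Type u} [CommRing R] [IsNoetherianRing R]

lemma loc_free (p : Ideal R) [hp : p.IsPrime] (ω : Type u) [AddCommGroup ω] [Module R ω]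
    [Module.Finite R ω] (hω : Nontrivial (LocalizedModule p.primeCompl ω)) (n : ℕ) :
    ∀ (X : Type u) [AddCommGroup X] [Module R X] [Module.Finite R X],
    (∀ i, Subsingleton (AExt R (i+1) X ω)) →
    HasProjectiveDimensionLT (ModuleCat.of (Localization.AtPrime p)
      (LocalizedModule p.primeCompl X)) (n+1) →
    Module.Free (Localization.AtPrime p) (LocalizedModule p.primeCompl X) := by
  induction n with
  | zero =>
    intro X _ _ _ _ h
    have : Module.Projective (Localization.AtPrime p) (LocalizedModule p.primeCompl X) :=
      (IsProjective.iff_projective _).2 (projective_iff_hasProjectiveDimensionLT_one.2 h)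
    exact Module.free_of_flat_of_isLocalRing
  | succ n ih =>
    intro X _ _ _ hX hpd
    obtain ⟨m, g, hg⟩ := Module.Finite.exists_fin' R X
    let F := Fin m → R
    let Z := LinearMap.ker g
    let l : Z →ₗ[R] F := Z.subtype
    have hl : Function.Injective l := Subtype.val_injective
    have hlg : Function.Exact l g := LinearMap.exact_subtype_ker_map g
    let S := p.primeCompl
    let A := Localization.AtPrime p
    have hl' := LocalizedModule.map_injective S l hl
    have hg' := LocalizedModule.map_surjective S g hg
    have hlg' : Function.Exact (LocalizedModule.map S l) (LocalizedModule.map S g) :=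
      LocalizedModule.map_exact S l g hlg
    have hFfree : Module.Free A (LocalizedModule S F) :=
      Module.free_of_isLocalizedModule S (LocalizedModule.mkLinearMap S F)
    have hZ : Module.Free A (LocalizedModule S Z) := by
      refine ih Z (fun i => sub_left ω l g (i+1) hl hlg hg (ext_free ω _ i) (hX (i+1))) ?_
      obtain ⟨w, hS⟩ := ses (R := A) (X₁ := LocalizedModule S Z) (X₂ := LocalizedModule S F)
        (X₃ := LocalizedModule S X) (LocalizedModule.map S l) (LocalizedModule.map S g) hl' hlg' hg'
      exact (hS.hasProjectiveDimensionLT_X₃_iff n ((IsProjective.iff_projective _).1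
        (inferInstanceAs (Module.Projective A (LocalizedModule S F))))).1 hpd
    refine free_of_extend A (LocalizedModule S Z) (LocalizedModule S F) (LocalizedModule S X)
      (LocalizedModule S ω) (LocalizedModule.map S l) (LocalizedModule.map S g) hg' hlg' ?_
    intro φ
    have : Module.FinitePresentation R Z := Module.finitePresentation_of_finite R Z
    obtain ⟨h', s, hs⟩ := Module.FinitePresentation.exists_lift_of_isLocalizedModule S
      (LocalizedModule.mkLinearMap S ω) ((φ.restrictScalars R) ∘ₗ LocalizedModule.mkLinearMap S Z)
    obtain ⟨ψ, hψ⟩ := (mem_ann_ext_one ω l g hl hlg hg (ext_free ω _ 0) 1).1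
      (by rw [Module.mem_annihilator]; intro x; have := hX 0; exact Subsingleton.elim _ _) h'
    rw [one_smul] at hψ
    refine ⟨(IsLocalization.mk' A 1 s : A) • LocalizedModule.map S ψ, ?_⟩
    ext x
    induction x using LocalizedModule.induction_on with
    | h z t =>
    have hsz : LocalizedModule.mk (h' z) 1 = s • φ (LocalizedModule.mk z 1) := LinearMap.congr_fun hs z
    have hψz : ψ (l z) = h' z := LinearMap.congr_fun hψ z
    have e1 : (LocalizedModule.mk z t : LocalizedModule S Z) =
      (IsLocalization.mk' A 1 t : A) • LocalizedModule.mk z 1 := by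
      rw [← Localization.mk_eq_mk', LocalizedModule.mk_smul_mk]; simp
    rw [e1, map_smul, map_smul]
    congr 1
    rw [LinearMap.comp_apply, LinearMap.smul_apply, LocalizedModule.map_mk, LocalizedModule.map_mk,
      hψz, hsz]
    rw [Submonoid.smul_def, ← algebraMap_smul A (s : R), smul_smul, IsLocalization.mk'_spec]
    simp

/-- The ideal of elements `r` with `r • id` factoring through a given surjection. -/
def factorIdeal {N P : Type u} [AddCommGroup N] [Module R N] [AddCommGroup P] [Module R P]
    (g : P →ₗ[R] N) : Ideal R where
  carrier := {r | ∃ h : N →ₗ[R] P, g ∘ₗ h = r • LinearMap.id}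
  zero_mem' := ⟨0, by simp⟩
  add_mem' := by
    rintro a b ⟨h, hh⟩ ⟨k, hk⟩
    exact ⟨h + k, by rw [LinearMap.comp_add, hh, hk, add_smul]⟩
  smul_mem' := by
    rintro c a ⟨h, hh⟩
    exact ⟨c • h, by rw [LinearMap.comp_smul, hh, smul_smul, smul_eq_mul]⟩

lemma factorIdeal_not_le {N P : Type u} [AddCommGroup N] [Module R N] [AddCommGroup P] [Module R P]
    [Module.Finite R N]
    (g : P →ₗ[R] N) (hg : Function.Surjective g) (p : Ideal R) [p.IsPrime]
    (hfree : Module.Free (Localization.AtPrime p) (LocalizedModule p.primeCompl N)) :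
    ¬ factorIdeal g ≤ p := by
  let S := p.primeCompl
  let A := Localization.AtPrime p
  obtain ⟨σ, hσ⟩ := Module.projective_lifting_property (R := A) (LocalizedModule.map S g)
    (LinearMap.id : LocalizedModule S N →ₗ[A] LocalizedModule S N)
    (LocalizedModule.map_surjective S g hg)
  have : Module.FinitePresentation R N := Module.finitePresentation_of_finite R N
  obtain ⟨h', s, hs⟩ := Module.FinitePresentation.exists_lift_of_isLocalizedModule S
      (LocalizedModule.mkLinearMap S P) ((σ.restrictScalars R) ∘ₗ LocalizedModule.mkLinearMap S N)
  obtain ⟨t, ht⟩ := Module.Finite.exists_smul_of_comp_eq_of_isLocalizedModule S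
    (LocalizedModule.mkLinearMap S N) (g ∘ₗ h') ((s : R) • LinearMap.id) (by
      ext z
      have hsz : LocalizedModule.mk (h' z) 1 = s • σ (LocalizedModule.mk z 1) :=
        LinearMap.congr_fun hs z
      have h2 : LocalizedModule.map S g (σ (LocalizedModule.mk z 1)) = LocalizedModule.mk z 1 :=
        LinearMap.congr_fun hσ _
      have h3 := congrArg (LocalizedModule.map S g) hsz
      rw [LocalizedModule.map_mk] at h3
      change LocalizedModule.mk (g (h' z)) 1 = LocalizedModule.mk ((s:R) • z) 1
      rw [h3]
      change LocalizedModule.map S g ((s : R) • _) = _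
      rw [← algebraMap_smul A (s : R), map_smul, h2, algebraMap_smul, LocalizedModule.smul'_mk])
  intro hle
  have : (t : R) * s ∈ p := hle ⟨(t : R) • h', by
    rw [LinearMap.comp_smul, ← smul_smul]; exact ht⟩
  exact (S.mul_mem t.2 s.2) this

lemma factor_kills {N P : Type u} [AddCommGroup N] [Module R N] [AddCommGroup P] [Module R P]
    [Module.Flat R P] (g : P →ₗ[R] N) (r : R) (hr : r ∈ factorIdeal g)
    {K Q : Type u} [AddCommGroup K] [Module R K] [AddCommGroup Q] [Module R Q]
    (i : K →ₗ[R] Q) (hi : Function.Injective i) (z : TensorProduct R K N)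
    (hz : i.rTensor N z = 0) : r • z = 0 := by
  obtain ⟨h, hh⟩ := hr
  have h1 : i.rTensor P (h.lTensor K z) = 0 := by
    rw [← LinearMap.comp_apply, LinearMap.rTensor_comp_lTensor, ← LinearMap.lTensor_comp_rTensor,
      LinearMap.comp_apply, hz, map_zero]
  have h2 : h.lTensor K z = 0 :=
    (injective_iff_map_eq_zero _).1 (Module.Flat.rTensor_preserves_injective_linearMap i hi) _ h1
  have h3 : (g ∘ₗ h).lTensor K z = r • z := by
    rw [hh, LinearMap.lTensor_smul, LinearMap.lTensor_id]; rfl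
  rw [← h3, LinearMap.lTensor_comp_apply, h2, map_zero]

end freeness

section assembly
open TensorProduct
variable {R : Type u} [CommRing R]

section seqs
variable {K P X : Type u} [AddCommGroup K] [Module R K] [AddCommGroup P] [Module R P]
  [AddCommGroup X] [Module R X]

lemma exact_a (t : K →ₗ[R] P) :
    Function.Exact (LinearMap.ker t).subtype t.rangeRestrict := by
  intro x
  rw [← LinearMap.mem_ker, LinearMap.ker_rangeRestrict]
  simp

lemma exact_b (t : K →ₗ[R] P) (q : P →ₗ[R] X) (h : Function.Exact t q) :
    Function.Exact (LinearMap.range t).subtype q := by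
  intro x
  rw [h x]
  simp
end seqs

variable {N : Type u} [AddCommGroup N] [Module R N] {ω : Type u} [AddCommGroup ω] [Module R ω]

/-- Comparison of the Ext^1 annihilators, in terms of extension of maps. -/
lemma mem_ann_ext_one_tensor {K P X : Type u} [AddCommGroup K] [Module R K] [Module.Finite R K]
    [AddCommGroup P] [Module R P] [Module.Free R P] [AddCommGroup X] [Module R X]
    (i : K →ₗ[R] P) (q : P →ₗ[R] X) (hi : Function.Injective i) (hiq : Function.Exact i q)
    (hq : Function.Surjective q) (r : R) :
    r ∈ Module.annihilator R (AExt R 1 X (N →ₗ[R] ω)) ↔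
      ∀ φ : K ⊗[R] N →ₗ[R] ω, ∃ ψ : P ⊗[R] N →ₗ[R] ω, ψ ∘ₗ i.rTensor N = r • φ := by
  rw [mem_ann_ext_one _ i q hi hiq hq (ext_free _ P 0)]
  constructor
  · intro h φ
    obtain ⟨ψ, hψ⟩ := h (TensorProduct.curry φ)
    refine ⟨TensorProduct.lift ψ, ?_⟩
    ext a b
    simpa using LinearMap.congr_fun (LinearMap.congr_fun hψ a) b
  · intro h φ
    obtain ⟨ψ, hψ⟩ := h (TensorProduct.lift φ)
    refine ⟨TensorProduct.curry ψ, ?_⟩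
    ext a b
    simpa using LinearMap.congr_fun hψ (a ⊗ₜ b)

variable [IsNoetherianRing R] [IsLocalRing R]

lemma tensor_zero (d k : ℕ) (hk : ∀ i, i ≠ d → Subsingleton (AExt R i (ResidueField R) ω))
    (hN : ∀ j, Subsingleton (AExt R (j+1) N ω)) [Module.Finite R N]
    (hkill : ∀ (K P : Type u) [AddCommGroup K] [Module R K] [AddCommGroup P] [Module R P]
      (i : K →ₗ[R] P), Function.Injective i → 
      maximalIdeal R ^ k ≤ Module.annihilator R (LinearMap.ker (i.rTensor N)))
    {K P X : Type u} [AddCommGroup K] [Module R K] [Module.Finite R K]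
    [AddCommGroup P] [Module R P] [Module.Free R P] [Module.Finite R P]
    [AddCommGroup X] [Module R X]
    (i : K →ₗ[R] P) (q : P →ₗ[R] X) (hi : Function.Injective i) (hiq : Function.Exact i q)
    (hq : Function.Surjective q) (hj : 1 ≤ d) :
    Module.annihilator R (AExt R 1 X (N →ₗ[R] ω)) = 
      Module.annihilator R (AExt R 1 (X ⊗[R] N) ω) := by
  have hT := rTensor_exact N hiq hq
  ext r
  rw [mem_ann_ext_one_tensor i q hi hiq hq]
  set t := i.rTensor N with ht
  rw [mem_ann_ext_one ω (LinearMap.range t).subtype (q.rTensor N) Subtype.val_injective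
    (exact_b t _ hT) (LinearMap.rTensor_surjective N hq) (sub_tensor _ _ _ (hN 0) _)]
  have h0 : Subsingleton (AExt R 0 (LinearMap.ker t) ω) :=
    fl_vanish ω 0 (hk 0 (by omega)) _ k (hkill _ _ _ hi)
  constructor
  · intro h φ
    obtain ⟨ψ, hψ⟩ := h (φ ∘ₗ t.rangeRestrict)
    refine ⟨ψ, ?_⟩
    ext ⟨_, a, rfl⟩
    exact LinearMap.congr_fun hψ a
  · intro h φ
    have hz : φ ∘ₗ (LinearMap.ker t).subtype = 0 := 
      (ext0 ω).symm.injective (Subsingleton.elim _ _)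
    have hle : LinearMap.ker t.rangeRestrict ≤ LinearMap.ker φ := by
      rw [LinearMap.ker_rangeRestrict]
      intro x hx
      exact LinearMap.congr_fun hz ⟨x, hx⟩
    have hs : Function.Surjective t.rangeRestrict := LinearMap.surjective_rangeRestrict t
    obtain ⟨φ', hφ'⟩ : ∃ φ' : LinearMap.range t →ₗ[R] ω, φ' ∘ₗ t.rangeRestrict = φ := by
      refine ⟨(LinearMap.ker t.rangeRestrict).liftQ φ hle ∘ₗ 
        (t.rangeRestrict.quotKerEquivOfSurjective hs).symm.toLinearMap, ?_⟩
      ext1 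
      ext a b
      have : (t.rangeRestrict.quotKerEquivOfSurjective hs).symm (t.rangeRestrict (a ⊗ₜ b)) 
          = Submodule.Quotient.mk (a ⊗ₜ b) := by
        rw [LinearEquiv.symm_apply_eq]; rfl
      simp only [TensorProduct.AlgebraTensorModule.curry_apply, LinearMap.restrictScalars_self,
        TensorProduct.curry_apply, LinearMap.comp_apply, LinearEquiv.coe_coe]
      rw [this]
      simp
    obtain ⟨ψ, hψ⟩ := h φ'
    refine ⟨ψ, ?_⟩
    rw [← hφ', ← LinearMap.smul_comp, ← hψ]
    rfl

lemma tensor_succ (d k : ℕ) (hk : ∀ i, i ≠ d → Subsingleton (AExt R i (ResidueField R) ω))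
    (hN : ∀ j, Subsingleton (AExt R (j+1) N ω)) [Module.Finite R N]
    (hkill : ∀ (K P : Type u) [AddCommGroup K] [Module R K] [AddCommGroup P] [Module R P]
      (i : K →ₗ[R] P), Function.Injective i → 
      maximalIdeal R ^ k ≤ Module.annihilator R (LinearMap.ker (i.rTensor N)))
    {K P X : Type u} [AddCommGroup K] [Module R K] [Module.Finite R K]
    [AddCommGroup P] [Module R P] [Module.Free R P] [Module.Finite R P]
    [AddCommGroup X] [Module R X]
    (i : K →ₗ[R] P) (q : P →ₗ[R] X) (hi : Function.Injective i) (hiq : Function.Exact i q)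
    (hq : Function.Surjective q) (j : ℕ) (hj : j + 2 ≤ d) :
    Module.annihilator R (AExt R (j+1) (K ⊗[R] N) ω) = 
      Module.annihilator R (AExt R (j+1+1) (X ⊗[R] N) ω) := by
  have hT := rTensor_exact N hiq hq
  set t := i.rTensor N with ht
  rw [← ann_shift ω (LinearMap.range t).subtype (q.rTensor N) (j+1) Subtype.val_injective
    (exact_b t _ hT) (LinearMap.rTensor_surjective N hq) (sub_tensor _ _ _ (hN _) _)
    (sub_tensor _ _ _ (hN _) _)]
  symm
  exact ann_right ω (LinearMap.ker t).subtype t.rangeRestrict j Subtype.val_injective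
    (exact_a t) (LinearMap.surjective_rangeRestrict t)
    (fl_vanish ω _ (hk _ (by omega)) _ k (hkill _ _ _ hi))
    (fl_vanish ω _ (hk _ (by omega)) _ k (hkill _ _ _ hi))


lemma tensor_ann (d k : ℕ) (hk : ∀ i, i ≠ d → Subsingleton (AExt R i (ResidueField R) ω))
    (hN : ∀ j, Subsingleton (AExt R (j+1) N ω)) [Module.Finite R N]
    (hkill : ∀ (K P : Type u) [AddCommGroup K] [Module R K] [AddCommGroup P] [Module R P]
      (i : K →ₗ[R] P), Function.Injective i → 
      maximalIdeal R ^ k ≤ Module.annihilator R (LinearMap.ker (i.rTensor N)))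
    (j : ℕ) (hj : j + 1 ≤ d) : ∀ (X : Type u) [AddCommGroup X] [Module R X] [Module.Finite R X],
    Module.annihilator R (AExt R (j+1) X (N →ₗ[R] ω)) = 
      Module.annihilator R (AExt R (j+1) (X ⊗[R] N) ω) := by
  induction j with
  | zero =>
    intro X _ _ _
    obtain ⟨n, q, hq⟩ := Module.Finite.exists_fin' R X
    have hi : Function.Injective (LinearMap.ker q).subtype := Subtype.val_injective
    have hiq : Function.Exact (LinearMap.ker q).subtype q := LinearMap.exact_subtype_ker_map q
    exact tensor_zero d k hk hN hkill _ q hi hiq hq hj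
  | succ j ih =>
    intro X _ _ _
    obtain ⟨n, q, hq⟩ := Module.Finite.exists_fin' R X
    have hi : Function.Injective (LinearMap.ker q).subtype := Subtype.val_injective
    have hiq : Function.Exact (LinearMap.ker q).subtype q := LinearMap.exact_subtype_ker_map q
    rw [← ann_shift (N →ₗ[R] ω) _ q (j+1) hi hiq hq (ext_free _ _ j) (ext_free _ _ _)]
    rw [ih (by omega)]
    exact tensor_succ d k hk hN hkill _ q hi hiq hq j hj

/-- The main annihilator computation. -/
lemma main_ann (d k : ℕ) (hk : ∀ i, i ≠ d → Subsingleton (AExt R i (ResidueField R) ω))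
    (hne : ¬ Subsingleton (AExt R d (ResidueField R) ω)) [Module.Finite R ω]
    (hN : ∀ j, Subsingleton (AExt R (j+1) N ω)) [Module.Finite R N]
    (hkill : ∀ (K P : Type u) [AddCommGroup K] [Module R K] [AddCommGroup P] [Module R P]
      (i : K →ₗ[R] P), Function.Injective i → 
      maximalIdeal R ^ k ≤ Module.annihilator R (LinearMap.ker (i.rTensor N)))
    {K P T : Type u} [AddCommGroup K] [Module R K] [Module.Finite R K]
    [AddCommGroup P] [Module R P] [Module.Free R P] [Module.Finite R P]
    [AddCommGroup T] [Module R T]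
    (i : K →ₗ[R] P) (q : P →ₗ[R] T) (hi : Function.Injective i) (hiq : Function.Exact i q)
    (hq : Function.Surjective q) :
    Module.annihilator R (AExt R (d+1) T (N →ₗ[R] ω)) = 
      Module.annihilator R (LinearMap.ker (i.rTensor N)) := by
  have hfT : Module.Finite R T := Module.Finite.of_surjective q hq
  have hbig : ∀ j, d < j → ∀ (X : Type u) [AddCommGroup X] [Module R X] [Module.Finite R X],
      Subsingleton (AExt R j X ω) := fun j hj X _ _ _ =>
    id_lemma ω d (fun i hi => hk i (by omega)) X j hj
  have hT := rTensor_exact N hiq hq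
  set t := i.rTensor N with ht
  have hfl := fl_ann ω d hk hne (LinearMap.ker t) k (hkill _ _ _ hi)
  cases d with
  | zero => 
    rw [← hfl]
    have hext : ∀ f : LinearMap.range t →ₗ[R] ω, ∃ g : P ⊗[R] N →ₗ[R] ω,
        g ∘ₗ (LinearMap.range t).subtype = f := by
      intro f
      have h := (mem_ann_ext_one ω (LinearMap.range t).subtype (q.rTensor N) Subtype.val_injective
        (exact_b t _ hT) (LinearMap.rTensor_surjective N hq) (hbig 1 one_pos _) 1).1
        (by
          have := hbig 1 one_pos (T ⊗[R] N)
          rw [Module.annihilator_eq_top_iff.2 this]; trivial) f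
      simpa using h
    have hext2 : ∀ f : LinearMap.ker t →ₗ[R] ω, ∃ g : K ⊗[R] N →ₗ[R] ω,
        g ∘ₗ (LinearMap.ker t).subtype = f := by
      intro f
      have h := (mem_ann_ext_one ω (LinearMap.ker t).subtype t.rangeRestrict Subtype.val_injective
        (exact_a t) (LinearMap.surjective_rangeRestrict t) (hbig 1 one_pos _) 1).1
        (by
          have := hbig 1 one_pos (LinearMap.range t)
          rw [Module.annihilator_eq_top_iff.2 this]; trivial) f
      simpa using h
    have hs : Function.Surjective t.rangeRestrict := LinearMap.surjective_rangeRestrict t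
    rw [(ext0 ω (X₁ := LinearMap.ker t)).annihilator_eq]
    ext r
    rw [mem_ann_ext_one_tensor i q hi hiq hq, Module.mem_annihilator]
    constructor
    · intro h f
      obtain ⟨φ, rfl⟩ := hext2 f
      obtain ⟨ψ, hψ⟩ := h φ
      rw [← LinearMap.smul_comp, ← hψ]
      ext ⟨x, hx⟩
      change ψ (t x) = 0
      rw [LinearMap.mem_ker.1 hx, map_zero]
    · intro h φ
      have hz := h (φ ∘ₗ (LinearMap.ker t).subtype)
      have hle : LinearMap.ker t.rangeRestrict ≤ LinearMap.ker (r • φ) := by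
        rw [LinearMap.ker_rangeRestrict]
        intro x hx
        exact LinearMap.congr_fun hz ⟨x, hx⟩
      obtain ⟨g, hg⟩ := hext ((LinearMap.ker t.rangeRestrict).liftQ (r • φ) hle ∘ₗ 
          (t.rangeRestrict.quotKerEquivOfSurjective hs).symm.toLinearMap)
      refine ⟨g, LinearMap.ext fun a => ?_⟩
      have h1 := LinearMap.congr_fun hg (t.rangeRestrict a)
      have : (t.rangeRestrict.quotKerEquivOfSurjective hs).symm (t.rangeRestrict a) 
            = Submodule.Quotient.mk a := by
        rw [LinearEquiv.symm_apply_eq]; rfl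
      simp only [LinearMap.comp_apply, LinearEquiv.coe_coe] at h1
      rw [this] at h1
      simpa using h1
  | succ d =>
    rw [← hfl, ← ann_shift (N →ₗ[R] ω) i q (d+1) hi hiq hq (ext_free _ _ _) (ext_free _ _ _)]
    rw [tensor_ann (d+1) k hk hN hkill d le_rfl]
    have hB : Subsingleton (AExt R (d+1) (LinearMap.range t) ω) :=
      sub_left ω (LinearMap.range t).subtype (q.rTensor N) (d+1) Subtype.val_injective
        (exact_b t _ hT) (LinearMap.rTensor_surjective N hq) (sub_tensor _ _ _ (hN _) _)
        (hbig _ (by omega) _)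
    exact ann_left ω (LinearMap.ker t).subtype t.rangeRestrict (d+1) Subtype.val_injective
      (exact_a t) (LinearMap.surjective_rangeRestrict t) hB (hbig _ (by omega) _)
end assembly

section torsec
open TensorProduct
variable {R : Type u} [CommRing R]
variable {M N : Type u} [AddCommGroup M] [Module R M] [AddCommGroup N] [Module R N]

lemma dth_nat {F G : Type u} [AddCommGroup F] [Module R F] [AddCommGroup G] [Module R G]
    (d0 : F →ₗ[R] G) (w : Module.Dual R G ⊗[R] N) :
    dualTensorHom R F N (d0.dualMap.rTensor N w) = dualTensorHom R G N w ∘ₗ d0 := by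
  induction w with
  | zero => simp
  | add a b ha hb => simp only [map_add, ha, hb, LinearMap.add_comp]
  | tmul f n => ext x; simp

lemma stablyTrivial_eq [Module.Finite R M] :
    stablyTrivial R M N = LinearMap.range (dualTensorHom R M N) := by
  apply le_antisymm
  · rw [stablyTrivial, Submodule.span_le]
    rintro f ⟨F, _, _, hF, g, h, rfl⟩
    let b := Module.Free.chooseBasis R F
    obtain ⟨s, hs⟩ := (Module.Finite.fg_top : (⊤ : Submodule R M).FG)
    classical
    let S : Finset (Module.Free.ChooseBasisIndex R F) := s.biUnion fun x => (b.repr (g x)).support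
    refine ⟨∑ i ∈ S, (b.coord i ∘ₗ g) ⊗ₜ h (b i), ?_⟩
    refine LinearMap.ext_on hs ?_
    intro x hx
    simp only [map_sum, LinearMap.sum_apply, dualTensorHom_apply, LinearMap.comp_apply,
      Module.Basis.coord_apply]
    conv_rhs => rw [← b.linearCombination_repr (g x), Finsupp.linearCombination_apply, 
      Finsupp.sum, map_sum]
    symm
    have hsub : (b.repr (g x)).support ⊆ S := fun i hi => Finset.mem_biUnion.2 ⟨x, hx, hi⟩
    rw [Finset.sum_subset hsub]
    · exact Finset.sum_congr rfl fun i _ => map_smul _ _ _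
    · intro i _ hi
      rw [Finsupp.notMem_support_iff.1 hi]; simp
  · rintro _ ⟨w, rfl⟩
    induction w with
    | zero => simp
    | add a b ha hb => rw [map_add]; exact add_mem ha hb
    | tmul f n =>
      refine Submodule.subset_span ⟨R, _, _, inferInstance, f, LinearMap.toSpanSingleton R N n, ?_⟩
      ext x; simp

lemma tor_ann_abs {DM DG DF F G : Type u} [AddCommGroup F] [Module R F] [AddCommGroup G] [Module R G]
    [AddCommGroup DM] [Module R DM] [AddCommGroup DG] [Module R DG] [AddCommGroup DF] [Module R DF]
    (d0 : F →ₗ[R] G) (π : G →ₗ[R] M)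
    (hπ : Function.Surjective π) (hex : LinearMap.range d0 = LinearMap.ker π)
    (b : DM →ₗ[R] DG) (a : DG →ₗ[R] DF) (hba : Function.Exact b a)
    (θM : DM ⊗[R] N →ₗ[R] (M →ₗ[R] N)) (θG : DG ⊗[R] N ≃ₗ[R] (G →ₗ[R] N))
    (θF : DF ⊗[R] N ≃ₗ[R] (F →ₗ[R] N))
    (hb : ∀ v, θG (b.rTensor N v) = θM v ∘ₗ π)
    (ha : ∀ w, θF (a.rTensor N w) = θG w ∘ₗ d0) :
    Module.annihilator R ((M →ₗ[R] N) ⧸ LinearMap.range θM) =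
    Module.annihilator R (LinearMap.ker ((LinearMap.range a).subtype.rTensor N)) := by
  set K := LinearMap.range a with hK
  set t := K.subtype.rTensor N with ht
  let e : DG →ₗ[R] K := a.rangeRestrict
  have hes : Function.Surjective e := LinearMap.surjective_rangeRestrict _
  have hexact : Function.Exact b e := by
    intro x
    rw [← LinearMap.mem_ker, LinearMap.ker_rangeRestrict, LinearMap.mem_ker]
    exact hba x
  have hex2 : Function.Exact (b.rTensor N) (e.rTensor N) := rTensor_exact N hexact hes
  have hes2 := LinearMap.rTensor_surjective N hes
  have hte : ∀ w, θF (t (e.rTensor N w)) = θG w ∘ₗ d0 := by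
    intro w
    rw [← ha, ht, ← LinearMap.comp_apply, ← LinearMap.rTensor_comp]
    rfl
  let Φ : (M →ₗ[R] N) →ₗ[R] K ⊗[R] N :=
    e.rTensor N ∘ₗ θG.symm.toLinearMap ∘ₗ LinearMap.lcomp R N π
  have hΦ : ∀ f, Φ f = e.rTensor N (θG.symm (f ∘ₗ π)) := fun f => rfl
  have hrange : LinearMap.range Φ = LinearMap.ker t := by
    apply le_antisymm
    · rintro _ ⟨f, rfl⟩
      rw [LinearMap.mem_ker]
      apply θF.injective
      rw [hΦ, hte, map_zero, LinearEquiv.apply_symm_apply]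
      ext a
      have : π (d0 a) = 0 := by
        rw [← LinearMap.mem_ker, ← hex]; exact ⟨a, rfl⟩
      simp [this]
    · intro z hz
      obtain ⟨w, rfl⟩ := hes2 z
      have h0 : θG w ∘ₗ d0 = 0 := by rw [← hte, LinearMap.mem_ker.1 hz, map_zero]
      have hle : LinearMap.ker π ≤ LinearMap.ker (θG w) := by
        rw [← hex]; rintro _ ⟨a, rfl⟩; exact LinearMap.congr_fun h0 a
      refine ⟨(LinearMap.ker π).liftQ (θG w) hle ∘ₗ 
        (π.quotKerEquivOfSurjective hπ).symm.toLinearMap, ?_⟩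
      rw [hΦ]
      congr 1
      rw [LinearEquiv.symm_apply_eq]
      ext a
      have : (π.quotKerEquivOfSurjective hπ).symm (π a) = Submodule.Quotient.mk a := by
        rw [LinearEquiv.symm_apply_eq]; rfl
      simp [this]
  have hker : LinearMap.ker Φ = LinearMap.range θM := by
    ext f
    rw [LinearMap.mem_ker, hΦ, hex2]
    constructor
    · rintro ⟨v, hv⟩
      refine ⟨v, ?_⟩
      have := congrArg θG hv
      rw [LinearEquiv.apply_symm_apply, hb] at this
      exact (LinearMap.cancel_right hπ).1 this
    · rintro ⟨v, rfl⟩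
      refine ⟨v, ?_⟩
      rw [LinearEquiv.eq_symm_apply, hb]
  exact ((Submodule.quotEquivOfEq _ _ hker.symm).trans 
    (Φ.quotKerEquivRange.trans (LinearEquiv.ofEq _ _ hrange))).annihilator_eq

lemma tor_ann [Module.Finite R M]
    {F G : Type u} [AddCommGroup F] [Module R F] [AddCommGroup G] [Module R G]
    [Module.Free R F] [Module.Finite R F] [Module.Free R G] [Module.Finite R G]
    (d0 : F →ₗ[R] G) (π : G →ₗ[R] M)
    (hπ : Function.Surjective π) (hex : LinearMap.range d0 = LinearMap.ker π) :
    Module.annihilator R ((M →ₗ[R] N) ⧸ stablyTrivial R M N) =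
    Module.annihilator R (LinearMap.ker 
      ((LinearMap.range (LinearMap.dualMap d0)).subtype.rTensor N)) := by
  rw [stablyTrivial_eq]
  refine tor_ann_abs d0 π hπ hex π.dualMap d0.dualMap ?_ (dualTensorHom R M N)
    (dualTensorHomEquiv R G N) (dualTensorHomEquiv R F N) ?_ ?_
  · intro x
    constructor
    · intro hx
      have hle : LinearMap.ker π ≤ LinearMap.ker x := by
        rw [← hex]; rintro _ ⟨a, rfl⟩; exact LinearMap.congr_fun hx a
      refine ⟨(LinearMap.ker π).liftQ x hle ∘ₗ (π.quotKerEquivOfSurjective hπ).symm.toLinearMap, ?_⟩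
      ext a
      have : (π.quotKerEquivOfSurjective hπ).symm (π a) = Submodule.Quotient.mk a := by
        rw [LinearEquiv.symm_apply_eq]; rfl
      simp [this]
    · rintro ⟨y, rfl⟩
      ext a
      have : π (d0 a) = 0 := by
        rw [← LinearMap.mem_ker, ← hex]; exact ⟨a, rfl⟩
      simp [this]
  · intro v
    rw [← dth_nat]; simp
  · intro w
    have h := dth_nat (N := N) d0 w
    simpa using h
end torsec

section final
variable {R : Type u} [CommRing R] 
lemma sub_bridge (i : ℕ) (X Y : Type u) [AddCommGroup X] [Module R X] [AddCommGroup Y] [Module R Y] :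
    Subsingleton (ExtMod R i X Y) ↔ Subsingleton (AExt R i X Y) := by
  rw [← Module.annihilator_eq_top_iff (R := R), ← Module.annihilator_eq_top_iff (R := R), ← extAnn_eq]
  rfl

variable [IsNoetherianRing R] [IsLocalRing R]

lemma mcm_seq (d : ℕ) (hdim : ringKrullDim R = (d : ℕ)) (N : Type u) [AddCommGroup N] [Module R N]
    (hN : IsMCM R N) : ∃ rs : List R, (∀ r ∈ rs, r ∈ maximalIdeal R) ∧
      RingTheory.Sequence.IsWeaklyRegular N rs ∧ rs.length = d := by
  have h : moduleDepth R N = (d : ℕ∞) := by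
    have := hN.2
    rw [hdim] at this
    exact_mod_cast this
  by_cases hd : d = 0
  · subst hd
    exact ⟨[], by simp, by simp, rfl⟩
  · by_contra hcon
    push Not at hcon
    have hlt : moduleDepth R N ≤ ((d - 1 : ℕ) : ℕ∞) := by
      apply sSup_le
      rintro _ ⟨rs, h1, h2, rfl⟩
      have hle : (rs.length : ℕ∞) ≤ d := by
        rw [← h]; exact le_sSup ⟨rs, h1, h2, rfl⟩
      have hle' : rs.length ≤ d := by exact_mod_cast hle
      have := hcon rs h1 h2.1
      exact_mod_cast (by omega : rs.length ≤ d - 1)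
    rw [h] at hlt
    have : d ≤ d - 1 := by exact_mod_cast hlt
    omega

lemma exists_kill (d : ℕ) (ω : Type u) [AddCommGroup ω] [Module R ω] [Module.Finite R ω]
    (hk : ∀ i, i ≠ d → Subsingleton (AExt R i (ResidueField R) ω))
    (hne : ¬ Subsingleton (AExt R d (ResidueField R) ω))
    (hisolated : ∀ (p : Ideal R) (hp : p.IsPrime), p ≠ maximalIdeal R →
      IsRegularLocal (Localization.AtPrime p))
    (N : Type u) [AddCommGroup N] [Module R N] [Module.Finite R N]
    (hN : ∀ j, Subsingleton (AExt R (j+1) N ω)) :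
    ∃ k, ∀ (K P : Type u) [AddCommGroup K] [Module R K] [AddCommGroup P] [Module R P]
      (i : K →ₗ[R] P), Function.Injective i → 
      maximalIdeal R ^ k ≤ Module.annihilator R (LinearMap.ker (i.rTensor N)) := by
  obtain ⟨n, g, hg⟩ := Module.Finite.exists_fin' R N
  have hrad : maximalIdeal R ≤ (factorIdeal g).radical := by
    rw [Ideal.radical_eq_sInf]
    refine le_sInf ?_
    rintro p ⟨hle, hp⟩
    by_contra hcon
    have hne' : p ≠ maximalIdeal R := fun h => hcon h.ge
    have hreg := hisolated p hp hne'
    obtain ⟨m, hm⟩ := regular_pd _ hreg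
    have hnt : Nontrivial (LocalizedModule p.primeCompl ω) := by
      rw [← Module.mem_support_iff (p := ⟨p, hp⟩), Module.mem_support_iff_of_finite]
      intro r hr
      have : r = 0 := can_faithful ω d hk hne r (fun y => Module.mem_annihilator.1 hr y)
      rw [this]; exact p.zero_mem
    refine factorIdeal_not_le g hg p ?_ hle
    have := hm (LocalizedModule p.primeCompl N)
    exact loc_free p ω hnt m N hN (hasProjectiveDimensionLT_of_ge _ m (m+1) (by omega))
  obtain ⟨k, hk⟩ := Ideal.exists_pow_le_of_le_radical_of_fg hrad (IsNoetherian.noetherian _)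
  refine ⟨k, ?_⟩
  intro K P _ _ _ _ i hi r hr
  rw [Module.mem_annihilator]
  rintro ⟨z, hz⟩
  exact Subtype.ext (factor_kills g r (hk hr) i hi z hz)
end final

section wrap
variable {R : Type u} [CommRing R]
variable {N : Type u} [AddCommGroup N] [Module R N] {ω : Type u} [AddCommGroup ω] [Module R ω]
variable [IsNoetherianRing R] [IsLocalRing R]

lemma main_ann_sub (d k : ℕ) (hk : ∀ i, i ≠ d → Subsingleton (AExt R i (ResidueField R) ω))
    (hne : ¬ Subsingleton (AExt R d (ResidueField R) ω)) [Module.Finite R ω]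
    (hN : ∀ j, Subsingleton (AExt R (j+1) N ω)) [Module.Finite R N]
    (hkill : ∀ (K P : Type u) [AddCommGroup K] [Module R K] [AddCommGroup P] [Module R P]
      (i : K →ₗ[R] P), Function.Injective i → 
      maximalIdeal R ^ k ≤ Module.annihilator R (LinearMap.ker (i.rTensor N)))
    {P : Type u} [AddCommGroup P] [Module R P] [Module.Free R P] [Module.Finite R P]
    (K : Submodule R P) :
    Module.annihilator R (LinearMap.ker (K.subtype.rTensor N)) =
      extAnn R (d+1) (P ⧸ K) (N →ₗ[R] ω) := by
  rw [extAnn_eq]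
  symm
  exact main_ann d k hk hne hN hkill K.subtype K.mkQ Subtype.val_injective
    (LinearMap.exact_subtype_mkQ _) (Submodule.mkQ_surjective _)
end wrap

/-- For a `d`-dimensional complete Cohen–Macaulay local ring with canonical module `ω`
which is an isolated singularity, and MCM modules `M, N`:
`ann (Hom(M,N)/P(M,N)) = ann Ext^{d+1}(Tr M, Hom(N, ω))`. -/
theorem stmt14 (R : Type u) [CommRing R] [IsNoetherianRing R] [IsLocalRing R]
    [IsAdicComplete (maximalIdeal R) R]
    (d : ℕ) (hdim : ringKrullDim R = (d : ℕ)) (hCM : moduleDepth R R = (d : ℕ∞))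
    (ω : Type u) [AddCommGroup ω] [Module R ω] (hω : IsCanonicalModule R d ω)
    (hisolated : ∀ (p : Ideal R) (hp : p.IsPrime), p ≠ maximalIdeal R →
      IsRegularLocal (Localization.AtPrime p))
    (M N : Type u) [AddCommGroup M] [Module R M] [AddCommGroup N] [Module R N]
    (hM : IsMCM R M) (hN : IsMCM R N)
    -- a finite free presentation `F → G → M → 0`, giving the transpose `Tr M`
    (F G : Type u) [AddCommGroup F] [Module R F] [AddCommGroup G] [Module R G]
    (hF : Module.Free R F) (hFfin : Module.Finite R F)
    (hG : Module.Free R G) (hGfin : Module.Finite R G)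
    (d0 : F →ₗ[R] G) (π : G →ₗ[R] M)
    (hπ : Function.Surjective π) (hex : LinearMap.range d0 = LinearMap.ker π) :
    Module.annihilator R ((M →ₗ[R] N) ⧸ stablyTrivial R M N) =
      extAnn R (d + 1)
        (Module.Dual R F ⧸ LinearMap.range (LinearMap.dualMap d0)) (N →ₗ[R] ω) := by
  have hfM : Module.Finite R M := hM.1
  have hfN : Module.Finite R N := hN.1
  obtain ⟨hfω, hωk, ⟨eω⟩⟩ := hω
  have hk : ∀ i, i ≠ d → Subsingleton (AExt R i (ResidueField R) ω) := fun i hi =>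
    (sub_bridge i _ _).1 (hωk i hi)
  have hne : ¬ Subsingleton (AExt R d (ResidueField R) ω) := by
    intro h
    have h1 := (sub_bridge d _ _).2 h
    have h2 : Subsingleton (ResidueField R) := eω.symm.injective.subsingleton
    exact not_subsingleton _ h2
  obtain ⟨rs, hrs, hreg, hlen⟩ := mcm_seq d hdim N hN
  have hNv : ∀ j, Subsingleton (AExt R (j+1) N ω) := fun j =>
    mcm_vanish ω d (fun i hi => hk i (by omega)) rs N hrs hreg (j+1) (by omega)
  obtain ⟨k, hkill⟩ := exists_kill d ω hk hne hisolated N hNv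
  have hfree : Module.Free R (Module.Dual R F) := inferInstance
  have hfin : Module.Finite R (Module.Dual R F) := inferInstance
  exact (tor_ann d0 π hπ hex).trans
    (main_ann_sub (P := Module.Dual R F) d k hk hne hNv hkill _)
end
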